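/- arXiv:1506.07425 — 5 statements merged into one kernel-verified Lean document; each statement's English description precedes it below -/
import Mathlib

section
/- Let h be a nonzero bounded Borel measurable function on ℝ supported in [0,∞). Then the support of the Fourier transform of h (as a tempered distribution) is all of ℝ. -/
open MeasureTheory SchwartzMap

/-- The Fourier transform of a (bounded measurable) function `h`, viewed as a tempered
distribution: it pairs a Schwartz test function `φ` with `∫ h · 𝓕φ`. -/
noncomputable def distFourier (h : ℝ → ℂ) (φ : SchwartzMap ℝ ℂ) : ℂ :=
  ∫ t, h t * (SchwartzMap.fourierTransformCLM ℂ φ) t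

/-- The tempered distribution `ĥ` vanishes on an open set `U`. -/
def distFourierVanishesOn (h : ℝ → ℂ) (U : Set ℝ) : Prop :=
  ∀ φ : SchwartzMap ℝ ℂ, tsupport (⇑φ) ⊆ U → distFourier h φ = 0

/-- The support of the tempered distribution `ĥ`. -/
def distFourierSupport (h : ℝ → ℂ) : Set ℝ :=
  {x | ∀ U : Set ℝ, IsOpen U → x ∈ U → ¬ distFourierVanishesOn h U}

open Filter Topology Set FourierTransform Complex

/-- Rotated-product argument on a square with one side on the imaginary axis. -/
theorem half_square_vanish (G : ℂ → ℂ) (hc : ContinuousOn G {z | z.re ≤ 0})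
    (hd : DifferentiableOn ℂ G {z | z.re < 0}) (y s : ℝ) (hs : 0 < s)
    (h0 : ∀ v : ℝ, |v - y| ≤ s → G (v * I) = 0) : G (-s + y * I) = 0 := by
  set c : ℂ := -s + y * I with hcdef
  have cre : c.re = -s := by simp [hcdef]
  have cim : c.im = y := by simp [hcdef]
  let S : Set ℂ := {w | |w.re| < s ∧ |w.im| < s}
  let T : Set ℂ := {w | |w.re| ≤ s ∧ |w.im| ≤ s}
  have hSo : IsOpen S := by
    exact (isOpen_lt (continuous_abs.comp Complex.continuous_re) continuous_const).inter
      (isOpen_lt (continuous_abs.comp Complex.continuous_im) continuous_const)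
  have hTc : IsClosed T := by
    exact (isClosed_le (continuous_abs.comp Complex.continuous_re) continuous_const).inter
      (isClosed_le (continuous_abs.comp Complex.continuous_im) continuous_const)
  have hST : closure S ⊆ T :=
    closure_minimal (fun w hw => ⟨hw.1.le, hw.2.le⟩) hTc
  have hSb : Bornology.IsBounded S := by
    refine (Metric.isBounded_closedBall (x := (0:ℂ)) (r := s + s)).subset ?_
    intro w hw
    rw [mem_closedBall_zero_iff]
    have := Complex.norm_le_abs_re_add_abs_im w
    have h1 := hw.1
    have h2 := hw.2
    linarith
  -- single factors
  have key : ∀ a : ℂ, (a = 1 ∨ a = -1 ∨ a = I ∨ a = -I) →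
      DiffContOnCl ℂ (fun w => G (c + a * w)) S := by
    intro a ha
    constructor
    · apply hd.comp
      · fun_prop
      · intro w hw
        have h1 := abs_lt.1 hw.1
        have h2 := abs_lt.1 hw.2
        show (c + a * w).re < 0
        rcases ha with rfl | rfl | rfl | rfl <;> simp [cre] <;> linarith
    · apply hc.comp
      · fun_prop
      · intro w hw
        have hw := hST hw
        have h1 := abs_le.1 hw.1
        have h2 := abs_le.1 hw.2
        show (c + a * w).re ≤ 0
        rcases ha with rfl | rfl | rfl | rfl <;> simp [cre] <;> linarith
  have hP : DiffContOnCl ℂ (fun w => (G (c + 1 * w) * G (c + (-1) * w)) *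
      (G (c + I * w) * G (c + (-I) * w))) S := by
    have k1 := key 1 (by simp)
    have k2 := key (-1) (by simp)
    have k3 := key I (by simp)
    have k4 := key (-I) (by simp)
    exact ⟨(k1.1.mul k2.1).mul (k3.1.mul k4.1), (k1.2.mul k2.2).mul (k3.2.mul k4.2)⟩
  have hz : ∀ w : ℂ, w.re = 0 → |w.im - y| ≤ s → G w = 0 := by
    intro w h1 h2
    have : w = (w.im : ℂ) * I := by apply Complex.ext <;> simp [h1]
    rw [this]
    exact h0 _ h2
  have := Complex.norm_le_of_forall_mem_frontier_norm_le hSb hP (C := 0) (z := 0) ?_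
    (subset_closure ⟨by simpa using hs, by simpa using hs⟩)
  · rw [norm_le_zero_iff] at this
    simpa using this
  · intro w hw
    have hwT := hST (frontier_subset_closure hw)
    have hwS : w ∉ S := by
      rw [hSo.frontier_eq] at hw
      exact hw.2
    have e1 := abs_le.1 hwT.1
    have e2 := abs_le.1 hwT.2
    have hcase : w.re = s ∨ w.re = -s ∨ w.im = s ∨ w.im = -s := by
      by_contra hcon
      push Not at hcon
      obtain ⟨n1, n2, n3, n4⟩ := hcon
      exact hwS ⟨abs_lt.2 ⟨lt_of_le_of_ne e1.1 n2.symm, lt_of_le_of_ne e1.2 n1⟩,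
        abs_lt.2 ⟨lt_of_le_of_ne e2.1 n4.symm, lt_of_le_of_ne e2.2 n3⟩⟩
    rw [norm_le_zero_iff]
    rcases hcase with h | h | h | h
    · rw [hz (c + 1 * w) (by simp [cre, h]) (by rw [abs_le]; simp [cim]; exact e2)]; simp
    · rw [hz (c + (-1) * w) (by simp [cre, h])
        (by rw [abs_le]; simp [cim]; constructor <;> linarith)]; simp
    · rw [hz (c + (-I) * w) (by simp [cre, h])
        (by rw [abs_le]; simp [cim]; constructor <;> linarith)]; simp
    · rw [hz (c + I * w) (by simp [cre, h])
        (by rw [abs_le]; simp [cim]; exact e1)]; simp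

theorem half_plane_vanish (G : ℂ → ℂ) (hc : ContinuousOn G {z | z.re ≤ 0})
    (hd : DifferentiableOn ℂ G {z | z.re < 0}) (y₀ δ : ℝ) (hδ : 0 < δ)
    (h0 : ∀ v : ℝ, |v - y₀| < δ → G (v * I) = 0) (z : ℂ) (hz : z.re < 0) : G z = 0 := by
  have ho : IsOpen {z : ℂ | z.re < 0} := isOpen_lt (by fun_prop) (by fun_prop)
  have hconv : IsPreconnected {z : ℂ | z.re < 0} := (convex_halfSpace_re_lt 0).isPreconnected
  have han := hd.analyticOnNhd ho
  let z₀ : ℂ := -(δ / 4 : ℝ) + y₀ * I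
  have hev : G =ᶠ[𝓝 z₀] 0 := by
    have hop : IsOpen {w : ℂ | w.re < 0 ∧ -w.re < δ / 2 ∧ |w.im - y₀| < δ / 2} :=
      ho.inter ((isOpen_lt Complex.continuous_re.neg continuous_const).inter
        (isOpen_lt (continuous_abs.comp (Complex.continuous_im.sub continuous_const))
          continuous_const))
    have hm : z₀ ∈ {w : ℂ | w.re < 0 ∧ -w.re < δ / 2 ∧ |w.im - y₀| < δ / 2} := by
      refine ⟨?_, ?_, ?_⟩ <;> simp [z₀] <;> linarith
    filter_upwards [hop.mem_nhds hm] with w hw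
    obtain ⟨w1, w2, w3⟩ := hw
    have := half_square_vanish G hc hd w.im (-w.re) (by linarith) (fun v hv => h0 v (by
      have := abs_sub_le v w.im y₀
      linarith))
    have e : (-((-w.re : ℝ) : ℂ) + w.im * I) = w := by apply Complex.ext <;> simp
    rw [e] at this
    exact this
  have hm : z₀ ∈ {z : ℂ | z.re < 0} := by simp [z₀]; linarith
  exact han.eqOn_zero_of_preconnected_of_eventuallyEq_zero hconv hm hev hz

theorem laplace_props (u : ℝ → ℂ) (hu : Integrable u) (htu : Integrable (fun t : ℝ => (t : ℂ) * u t))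
    (hsupp : ∀ t < 0, u t = 0) :
    ContinuousOn (fun z : ℂ => ∫ t : ℝ, u t * cexp (t * z)) {z | z.re ≤ 0} ∧
    DifferentiableOn ℂ (fun z : ℂ => ∫ t : ℝ, u t * cexp (t * z)) {z | z.re < 0} := by
  have hexp : ∀ z : ℂ, z.re ≤ 0 → ∀ t : ℝ, 0 ≤ t → ‖cexp (t * z)‖ ≤ 1 := by
    intro z hz t ht
    rw [Complex.norm_exp]
    simp
    exact mul_nonpos_of_nonneg_of_nonpos ht hz
  have hb : ∀ z : ℂ, z.re ≤ 0 → ∀ t : ℝ, ‖u t * cexp (t * z)‖ ≤ ‖u t‖ := by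
    intro z hz t
    rcases lt_or_ge t 0 with ht | ht
    · simp [hsupp t ht]
    · rw [norm_mul]
      exact mul_le_of_le_one_right (norm_nonneg _) (hexp z hz t ht)
  have hmeas : ∀ z : ℂ, AEStronglyMeasurable (fun t : ℝ => u t * cexp (t * z)) volume :=
    fun z => hu.1.mul (by fun_prop : Continuous fun t : ℝ => cexp (t * z)).aestronglyMeasurable
  constructor
  · apply continuousOn_of_dominated (bound := fun t => ‖u t‖)
    · exact fun z _ => hmeas z
    · exact fun z hz => ae_of_all _ (hb z hz)
    · exact hu.norm
    · exact ae_of_all _ fun t => by fun_prop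
  · intro z hz
    have ho : IsOpen {z : ℂ | z.re < 0} := isOpen_lt (by fun_prop) (by fun_prop)
    have := hasDerivAt_integral_of_dominated_loc_of_deriv_le (μ := (volume : Measure ℝ))
      (F := fun (z : ℂ) (t : ℝ) => u t * cexp (t * z))
      (F' := fun (z : ℂ) (t : ℝ) => (t * u t) * cexp (t * z))
      (bound := fun t => ‖(t : ℂ) * u t‖) (ho.mem_nhds hz)
      (Eventually.of_forall hmeas)
      (hu.mono (hmeas z) (ae_of_all _ (hb z (le_of_lt hz))))
      (htu.1.mul (by fun_prop : Continuous fun t : ℝ => cexp (t * z)).aestronglyMeasurable)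
      (ae_of_all _ fun t w hw => by
        rcases lt_or_ge t 0 with ht | ht
        · simp [hsupp t ht]
        · rw [norm_mul]
          exact mul_le_of_le_one_right (norm_nonneg _) (hexp w (le_of_lt hw) t ht))
      htu.norm
      (ae_of_all _ fun t w hw => by
        have h1 : HasDerivAt (fun w : ℂ => (t : ℂ) * w) (t : ℂ) w := by
          simpa using (hasDerivAt_id w).const_mul (t : ℂ)
        have := (h1.cexp).const_mul (u t)
        convert! this using 1
        ring)
    exact this.2.differentiableAt.differentiableWithinAt

theorem ae_zero_of_fourier_zero (f : ℝ → ℂ) (hf : Integrable f) (h : ∀ ξ, 𝓕 f ξ = 0) :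
    ∀ᵐ t, f t = 0 := by
  apply ae_eq_zero_of_integral_contDiff_smul_eq_zero hf.locallyIntegrable
  intro g g_smooth g_cpt
  have hg₁ : HasCompactSupport (Complex.ofRealCLM ∘ g) := g_cpt.comp_left rfl
  have hg₂ : ContDiff ℝ (⊤ : ℕ∞) (Complex.ofRealCLM ∘ g) := by fun_prop
  let φ : SchwartzMap ℝ ℂ := hg₁.toSchwartzMap hg₂
  let ψ : SchwartzMap ℝ ℂ := 𝓕⁻ φ
  have hψ : 𝓕 (ψ : ℝ → ℂ) = φ := by
    rw [← SchwartzMap.fourier_coe, FourierTransform.fourier_fourierInv_eq]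
  have e : ∫ ξ, 𝓕 (ψ : ℝ → ℂ) ξ • f ξ = ∫ x, ψ x • 𝓕 f x := by
    simpa using! VectorFourier.integral_fourierIntegral_smul_eq_flip (L := innerₗ ℝ)
      Real.continuous_fourierChar continuous_inner ψ.integrable hf
  rw [hψ] at e
  simp only [h, smul_zero, integral_zero] at e
  rw [← e]
  congr 1

theorem core (u : ℝ → ℂ) (hu : Integrable u) (htu : Integrable (fun t : ℝ => (t : ℂ) * u t))
    (hsupp : ∀ t < 0, u t = 0) (y₀ δ : ℝ) (hδ : 0 < δ)
    (h0 : ∀ v : ℝ, |v - y₀| < δ → ∫ t : ℝ, u t * cexp (t * (v * I)) = 0) :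
    ∀ᵐ t, u t = 0 := by
  obtain ⟨hc, hd⟩ := laplace_props u hu htu hsupp
  have hG := half_plane_vanish _ hc hd y₀ δ hδ h0
  have hf : Integrable (fun t : ℝ => u t * cexp (-t)) := by
    refine hu.mono (hu.1.mul
      (by fun_prop : Continuous fun t : ℝ => cexp (-t)).aestronglyMeasurable) (ae_of_all _ ?_)
    intro t
    rcases lt_or_ge t 0 with ht | ht
    · simp [hsupp t ht]
    · rw [norm_mul]
      refine mul_le_of_le_one_right (norm_nonneg _) ?_
      rw [Complex.norm_exp]
      simpa using ht
  have := ae_zero_of_fourier_zero _ hf (fun ξ => by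
    rw [Real.fourier_real_eq_integral_exp_smul]
    have := hG (-1 + (-2 * Real.pi * ξ : ℝ) * I) (by simp)
    rw [← this]
    congr 1
    ext t
    rw [smul_eq_mul, mul_left_comm, ← Complex.exp_add]
    congr 2
    push_cast
    ring)
  filter_upwards [this] with t ht
  simpa using ht

theorem fourier_translate (φ : ℝ → ℂ) (ξ t : ℝ) :
    𝓕 (fun y => φ (y - ξ)) t = cexp (t * ((-2 * Real.pi * ξ : ℝ) * I)) * 𝓕 φ t := by
  rw [Real.fourier_real_eq_integral_exp_smul, Real.fourier_real_eq_integral_exp_smul,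
    ← integral_const_mul,
    ← integral_sub_right_eq_self
      (fun v : ℝ => cexp (t * ((-2 * Real.pi * ξ : ℝ) * I)) *
        (cexp (↑(-2 * Real.pi * v * t) * I) • φ v)) ξ]
  congr 1
  ext v
  rw [smul_eq_mul, smul_eq_mul, ← mul_assoc, ← Complex.exp_add]
  congr 2
  push_cast
  ring

theorem fourier_scale (φ : ℝ → ℂ) (n : ℝ) (hn : 0 < n) (t : ℝ) :
    𝓕 (fun y => φ (n * y)) t = (n⁻¹ : ℝ) • 𝓕 φ (t / n) := by
  rw [Real.fourier_real_eq_integral_exp_smul, Real.fourier_real_eq_integral_exp_smul]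
  have := Measure.integral_comp_mul_left
    (fun v : ℝ => cexp (↑(-2 * Real.pi * v * (t / n)) * I) • φ v) n
  rw [abs_of_pos (inv_pos.2 hn)] at this
  rw [← this]
  congr 1
  ext v
  congr 4
  field_simp

theorem mul_fourier_ae_zero (h : ℝ → ℂ) (C : ℝ) (hmeas : Measurable h) (hbd : ∀ t, ‖h t‖ ≤ C)
    (hsupp : ∀ t < (0 : ℝ), h t = 0) (U : Set ℝ) (hv : distFourierVanishesOn h U)
    (x r : ℝ) (hr : 0 < r) (hU : Metric.ball x (r + r) ⊆ U) (φ : ℝ → ℂ)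
    (hφ : ContDiff ℝ (⊤ : ℕ∞) φ) (hφs : ∀ y, r / 2 < |y| → φ y = 0) :
    ∀ᵐ t, h t * 𝓕 φ t = 0 := by
  have hsub : ∀ ξ : ℝ, tsupport (fun y => φ (y - ξ)) ⊆ Metric.closedBall ξ (r / 2) := by
    intro ξ
    refine closure_minimal ?_ Metric.isClosed_closedBall
    intro y hy
    by_contra hcon
    rw [Metric.mem_closedBall, Real.dist_eq, not_le] at hcon
    exact hy (hφs _ hcon)
  have hcs : ∀ ξ : ℝ, HasCompactSupport (fun y => φ (y - ξ)) := fun ξ =>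
    (isCompact_closedBall ξ (r / 2)).of_isClosed_subset (isClosed_tsupport _) (hsub ξ)
  have hsm : ∀ ξ : ℝ, ContDiff ℝ (⊤ : ℕ∞) (fun y => φ (y - ξ)) := fun ξ =>
    hφ.comp (by fun_prop)
  let Φ : ℝ → SchwartzMap ℝ ℂ := fun ξ => (hcs ξ).toSchwartzMap (hsm ξ)
  have hΦ : ∀ ξ t, (SchwartzMap.fourierTransformCLM ℂ (Φ ξ)) t
      = cexp (t * ((-2 * Real.pi * ξ : ℝ) * I)) * 𝓕 φ t := by
    intro ξ t
    rw [← fourier_translate]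
    rfl
  let ψ : SchwartzMap ℝ ℂ := 𝓕 (Φ 0)
  have hψ : ∀ t, ψ t = 𝓕 φ t := by
    intro t
    have := hΦ 0 t
    simp only [mul_zero, ofReal_zero, zero_mul, Complex.exp_zero, one_mul] at this
    exact this
  simp_rw [← hψ] at hΦ ⊢
  have hmb : ∀ᵐ t, ‖h t‖ ≤ C := ae_of_all _ hbd
  apply core (fun t => h t * ψ t) (ψ.integrable.bdd_mul hmeas.aestronglyMeasurable hmb)
    ?_ (fun t ht => by simp [hsupp t ht]) (-2 * Real.pi * x) (2 * Real.pi * r) (by positivity)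
  · intro v hvv
    have hpi := Real.pi_pos
    obtain ⟨ξ, rfl⟩ : ∃ ξ, v = -2 * Real.pi * ξ := ⟨-v / (2 * Real.pi), by field_simp⟩
    have hξ : |ξ - x| < r := by
      rw [← mul_sub, abs_mul, abs_mul, abs_neg, abs_two, abs_of_pos hpi] at hvv
      exact lt_of_mul_lt_mul_left hvv (by positivity)
    have := hv (Φ ξ) (by
      refine (hsub ξ).trans (subset_trans ?_ hU)
      apply Metric.closedBall_subset_ball'
      rw [Real.dist_eq]
      linarith)
    unfold distFourier at this
    rw [← this]
    congr 1
    ext t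
    rw [hΦ]
    ring
  · have h1 : Integrable (fun t : ℝ => (t : ℂ) * ψ t) := by
      refine (ψ.integrable_pow_mul volume 1).mono
        (by fun_prop : Continuous fun t : ℝ => (t : ℂ) * ψ t).aestronglyMeasurable
        (ae_of_all _ fun t => by simp)
    refine (h1.bdd_mul hmeas.aestronglyMeasurable hmb).congr (ae_of_all _ fun t => ?_)
    simp only
    ring

/-- A nonzero bounded Borel measurable function on `ℝ` supported in `[0,∞)` has
distributional Fourier transform with full support. -/
theorem supp_distFourier_eq_univ_of_halfline (h : ℝ → ℂ) (C : ℝ)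
    (hmeas : Measurable h) (hbd : ∀ t, ‖h t‖ ≤ C)
    (hsupp : ∀ t < (0 : ℝ), h t = 0)
    (hne : ¬ (h =ᵐ[volume] 0)) :
    distFourierSupport h = Set.univ := by
  rw [Set.eq_univ_iff_forall]
  intro x U hUo hxU hv
  apply hne
  obtain ⟨ε, hε, hU⟩ := Metric.isOpen_iff.1 hUo x hxU
  let b : ContDiffBump (0 : ℝ) := ⟨ε / 8, ε / 4, by positivity, by linarith⟩
  let φ : ℝ → ℂ := fun y => (b y : ℂ)
  have hφ : ContDiff ℝ (⊤ : ℕ∞) φ := Complex.ofRealCLM.contDiff.comp b.contDiff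
  have hφs : ∀ y, ε / 4 ≤ |y| → φ y = 0 := by
    intro y hy
    have := b.zero_of_le_dist (x := y) (by simpa [Real.dist_eq] using hy)
    simp [φ, this]
  have hφc : HasCompactSupport φ := b.hasCompactSupport.comp_left (g := Complex.ofReal) rfl
  have hcont : Continuous (𝓕 φ) := (𝓕 (hφc.toSchwartzMap hφ)).continuous
  have hF0 : 𝓕 φ 0 ≠ 0 := by
    rw [Real.fourier_real_eq_integral_exp_smul]
    simp only [mul_zero, ofReal_zero, zero_mul, Complex.exp_zero, one_smul, φ]
    rw [integral_complex_ofReal]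
    exact_mod_cast (b.integral_pos (μ := volume)).ne'
  have hall : ∀ n : ℕ, ∀ᵐ t, h t * 𝓕 (fun y => φ (((n : ℝ) + 1) * y)) t = 0 := by
    intro n
    apply mul_fourier_ae_zero h C hmeas hbd hsupp U hv x (ε / 2) (by positivity)
      (by rwa [add_halves])
    · exact hφ.comp (by fun_prop)
    · intro y hy
      apply hφs
      have hn : (0 : ℝ) ≤ n := n.cast_nonneg
      rw [abs_mul, abs_of_pos (by positivity)]
      nlinarith [abs_nonneg y, mul_nonneg hn (abs_nonneg y)]
  filter_upwards [ae_all_iff.2 hall] with t ht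
  have hlim : Tendsto (fun n : ℕ => 𝓕 φ (t / ((n : ℝ) + 1))) atTop (𝓝 (𝓕 φ 0)) := by
    apply (hcont.tendsto 0).comp
    exact tendsto_const_nhds.div_atTop
      (tendsto_atTop_add_const_right _ _ tendsto_natCast_atTop_atTop)
  obtain ⟨n, hn⟩ := (hlim.eventually_ne hF0).exists
  have := ht n
  rw [fourier_scale φ _ (by positivity)] at this
  rcases mul_eq_zero.1 this with h1 | h1
  · exact h1
  · rw [smul_eq_zero] at h1
    rcases h1 with h1 | h1
    · exact absurd h1 (by positivity)
    · exact absurd h1 hn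
end

section
/- If φ ∈ L¹(ℝ) is supported in [0,∞) and ∫_ℝ log|φ̂(x)| / (1 + x²) dx = −∞, then φ = 0 almost everywhere. In particular, if φ ∈ L¹(ℝ) is supported in [0,∞) and φ̂ vanishes on a set of positive Lebesgue measure, then φ = 0 a.e. -/
open MeasureTheory Real

/-- Fourier transform with the paper's normalization `φ̂(x) = ∫ e^{-iπxt} φ(t) dt`. -/
noncomputable def paperFT (φ : ℝ → ℂ) (x : ℝ) : ℂ :=
  ∫ t : ℝ, Complex.exp (-(Complex.I * (Real.pi : ℂ) * (x : ℂ) * (t : ℂ))) * φ t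


open Filter Topology Metric in
/-- Negative logarithm with values in `[0,∞]`, infinite at `0`. -/
noncomputable def negLog (y : ℝ) : ENNReal := (-(ENNReal.log (ENNReal.ofReal y))).toENNReal

lemma negLog_continuous : Continuous negLog := by
  unfold negLog
  exact EReal.continuous_toENNReal.comp
    (continuous_neg.comp (ENNReal.continuous_log.comp ENNReal.continuous_ofReal))

lemma negLog_antitone : Antitone negLog := by
  intro a b h
  unfold negLog
  apply EReal.toENNReal_le_toENNReal
  apply EReal.neg_le_neg_iff.2
  exact ENNReal.log_monotone (ENNReal.ofReal_le_ofReal h)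

lemma negLog_zero : negLog 0 = ⊤ := by simp [negLog]

lemma negLog_pos {y : ℝ} (hy : 0 < y) : negLog y = ENNReal.ofReal (-Real.log y) := by
  unfold negLog
  rw [ENNReal.log_ofReal_of_pos hy, ← EReal.coe_neg, EReal.toENNReal_of_ne_top (by simp)]
  simp

open Filter Topology Metric in
lemma circle_bound (G : ℂ → ℂ) (hG : DifferentiableOn ℂ G (ball 0 1))
    (hb : ∀ w ∈ ball (0:ℂ) 1, ‖G w‖ ≤ 1) {w₀ : ℂ} (hw₀ : w₀ ∈ ball (0:ℂ) 1) (hne : G w₀ ≠ 0) :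
    ∃ C : ℝ, ∀ r : ℝ, 1 / 2 ≤ r → r < 1 → 
      ∫⁻ θ in Set.Ioo 0 (2 * π), negLog ‖G (circleMap 0 r θ)‖ ≤ ENNReal.ofReal C := by
  have hA : AnalyticOnNhd ℂ G (ball 0 1) := hG.analyticOnNhd isOpen_ball
  have hconn : IsConnected (ball (0:ℂ) 1) :=
    ⟨⟨0, by simp⟩, (convex_ball (0:ℂ) 1).isPreconnected⟩
  have hcod := hA.preimage_zero_mem_codiscreteWithin hne hw₀ hconn
  set D : ℤ := (meromorphicOrderAt G 0).untop₀
  refine ⟨-(2 * π * (-(D * Real.log 2) + Real.log ‖meromorphicTrailingCoeffAt G 0‖)), ?_⟩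
  intro r hr hr1
  have hr0 : 0 < r := by linarith
  have habs : |r| = r := abs_of_pos hr0
  have hsub : closedBall (0:ℂ) |r| ⊆ ball 0 1 := by
    rw [habs]; exact closedBall_subset_ball hr1
  have hA' : AnalyticOnNhd ℂ G (closedBall 0 |r|) := hA.mono hsub
  have hM : MeromorphicOn G (closedBall 0 |r|) := hA'.meromorphicOn
  have hmem : ∀ θ, circleMap 0 r θ ∈ ball (0:ℂ) 1 := fun θ => by
    simp [habs, hr1]
  have hJ := MeromorphicOn.circleAverage_log_norm hr0.ne' hM
  have h0 : (0:ℂ) ∈ closedBall (0:ℂ) |r| := by simp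
  have hDeq : MeromorphicOn.divisor G (closedBall 0 |r|) 0 = D :=
    MeromorphicOn.divisor_apply hM h0
  have hDnn := MeromorphicOn.AnalyticOnNhd.divisor_nonneg hA'
  have hD0 : 0 ≤ D := by rw [← hDeq]; exact hDnn 0
  have hfin : 0 ≤ ∑ᶠ u, (MeromorphicOn.divisor G (closedBall 0 |r|) u : ℝ) *
      Real.log (r * ‖0 - u‖⁻¹) := by
    apply finsum_nonneg
    intro u
    by_cases hu : u ∈ closedBall (0:ℂ) |r|
    · apply mul_nonneg
      · exact_mod_cast hDnn u
      · by_cases hu0 : u = 0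
        · simp [hu0]
        · apply Real.log_nonneg
          have : 0 < ‖u‖ := norm_pos_iff.2 hu0
          have h2 : ‖u‖ ≤ r := by simpa [habs] using hu
          rw [zero_sub, norm_neg, ← div_eq_mul_inv, le_div_iff₀ this]
          linarith
    · rw [Function.locallyFinsuppWithin.apply_eq_zero_of_notMem _ hu]; simp
  have hlog : -Real.log 2 ≤ Real.log r := by
    rw [← Real.log_inv]
    exact Real.log_le_log (by norm_num) (by linarith)
  have hlow : -(D * Real.log 2) + Real.log ‖meromorphicTrailingCoeffAt G 0‖
      ≤ circleAverage (fun z => Real.log ‖G z‖) 0 r := by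
    rw [hJ, hDeq]
    have : (0:ℝ) ≤ D := by exact_mod_cast hD0
    nlinarith
  have hint : CircleIntegrable (fun z => Real.log ‖G z‖) 0 r :=
    MeromorphicOn.circleIntegrable_log_norm (hM.mono_set sphere_subset_closedBall)
  have hae : ∀ᵐ θ : ℝ, G (circleMap 0 r θ) ≠ 0 := by
    have h1 : G ⁻¹' {0}ᶜ ∈ codiscreteWithin (sphere (0:ℂ) |r|) :=
      codiscreteWithin_mono (sphere_subset_closedBall.trans hsub) hcod
    have h2 := circleMap_preimage_codiscrete hr0.ne' h1
    have h3 := ae_restrict_le_codiscreteWithin (μ := (volume : Measure ℝ)) MeasurableSet.univ h2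
    rw [Measure.restrict_univ] at h3
    exact h3
  have hint' : IntegrableOn (fun θ => Real.log ‖G (circleMap 0 r θ)‖) (Set.Ioc 0 (2 * π)) := by
    have := hint
    unfold CircleIntegrable at this
    rwa [intervalIntegrable_iff_integrableOn_Ioc_of_le (by positivity)] at this
  calc ∫⁻ θ in Set.Ioo 0 (2 * π), negLog ‖G (circleMap 0 r θ)‖
      ≤ ∫⁻ θ in Set.Ioc 0 (2 * π), negLog ‖G (circleMap 0 r θ)‖ :=
        lintegral_mono_set Set.Ioo_subset_Ioc_self
    _ = ∫⁻ θ in Set.Ioc 0 (2 * π), ENNReal.ofReal (-Real.log ‖G (circleMap 0 r θ)‖) := by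
        apply lintegral_congr_ae
        filter_upwards [ae_restrict_of_ae hae] with θ hθ
        exact negLog_pos (norm_pos_iff.2 hθ)
    _ = ENNReal.ofReal (∫ θ in Set.Ioc 0 (2 * π), -Real.log ‖G (circleMap 0 r θ)‖) := by
        refine (ofReal_integral_eq_lintegral_ofReal (f := fun θ => -Real.log ‖G (circleMap 0 r θ)‖)
          hint'.neg ?_).symm
        filter_upwards with θ
        have := Real.log_nonpos (norm_nonneg _) (hb _ (hmem θ))
        simpa using this
    _ ≤ _ := by
        apply ENNReal.ofReal_le_ofReal
        rw [integral_neg, neg_le_neg_iff, ← intervalIntegral.integral_of_le (by positivity)]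
        rw [circleAverage_def, smul_eq_mul] at hlow
        have hp : 0 < 2 * π := by positivity
        rw [mul_comm, ← le_div_iff₀ hp, div_eq_inv_mul]
        exact hlow

open Filter Topology Metric in
lemma disc_lemma (G : ℂ → ℂ) (hG : DifferentiableOn ℂ G (ball 0 1))
    (hb : ∀ w ∈ ball (0:ℂ) 1, ‖G w‖ ≤ 1) {w₀ : ℂ} (hw₀ : w₀ ∈ ball (0:ℂ) 1) (hne : G w₀ ≠ 0)
    (g : ℝ → ℂ) (hg : ∀ θ ∈ Set.Ioo 0 (2 * π),
      Tendsto (fun r : ℝ => G (circleMap 0 r θ)) (𝓝[<] 1) (𝓝 (g θ))) :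
    ∫⁻ θ in Set.Ioo 0 (2 * π), negLog ‖g θ‖ < ⊤ := by
  obtain ⟨C, hC⟩ := circle_bound G hG hb hw₀ hne
  obtain ⟨u, -, hu, hul⟩ := exists_seq_strictMono_tendsto' (show (1/2:ℝ) < 1 by norm_num)
  have hul' : Tendsto u atTop (𝓝[<] 1) :=
    tendsto_nhdsWithin_iff.2 ⟨hul, Eventually.of_forall fun n => (hu n).2⟩
  have hcont : ∀ n, Continuous fun θ => negLog ‖G (circleMap 0 (u n) θ)‖ := by
    intro n
    apply negLog_continuous.comp
    apply Continuous.norm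
    apply hG.continuousOn.comp_continuous (continuous_circleMap 0 (u n))
    intro θ
    have h1 := (hu n).1
    have h2 := (hu n).2
    simp [abs_of_pos (show 0 < u n by linarith), h2]
  calc ∫⁻ θ in Set.Ioo 0 (2 * π), negLog ‖g θ‖
      = ∫⁻ θ in Set.Ioo 0 (2 * π), liminf (fun n => negLog ‖G (circleMap 0 (u n) θ)‖) atTop := by
        apply setLIntegral_congr_fun measurableSet_Ioo
        intro θ hθ
        symm
        apply Tendsto.liminf_eq
        exact (negLog_continuous.tendsto _).comp (((hg θ hθ).comp hul').norm)
    _ ≤ liminf (fun n => ∫⁻ θ in Set.Ioo 0 (2 * π), negLog ‖G (circleMap 0 (u n) θ)‖) atTop :=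
        lintegral_liminf_le fun n => (hcont n).measurable
    _ ≤ ENNReal.ofReal C := by
        apply liminf_le_of_frequently_le'
        exact Frequently.of_forall fun n => hC _ (hu n).1.le (hu n).2
    _ < ⊤ := ENNReal.ofReal_lt_top

open scoped FourierTransform SchwartzMap in
lemma fourier_inj (φ : ℝ → ℂ) (hφ : Integrable φ) (h : ∀ x, paperFT φ x = 0) :
    φ =ᵐ[volume] 0 := by
  have hF : 𝓕 φ = 0 := by
    ext x
    rw [Real.fourier_real_eq_integral_exp_smul]
    have := h (2 * x)
    unfold paperFT at this
    simp only [Pi.zero_apply, ← this, smul_eq_mul]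
    congr 1
    ext t
    congr 2
    push_cast
    ring
  refine ae_eq_zero_of_integral_contDiff_smul_eq_zero hφ.locallyIntegrable ?_
  intro g hg hgs
  let G : 𝓢(ℝ, ℂ) := HasCompactSupport.toSchwartzMap (f := fun x => (g x : ℂ))
    (hgs.comp_left (g := fun x : ℝ => (x:ℂ)) (by simp)) (Complex.ofRealCLM.contDiff.comp hg)
  have key := VectorFourier.integral_fourierIntegral_smul_eq_flip (e := Real.fourierChar)
    (μ := (volume : Measure ℝ)) (ν := (volume : Measure ℝ)) (L := innerₗ ℝ)
    Real.continuous_fourierChar continuous_inner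
    (𝓕⁻ G : 𝓢(ℝ, ℂ)).integrable hφ
  have e1 : ∀ ξ, VectorFourier.fourierIntegral Real.fourierChar volume (innerₗ ℝ)
      (⇑(𝓕⁻ G : 𝓢(ℝ, ℂ))) ξ = (g ξ : ℂ) := by
    intro ξ
    have : 𝓕 (𝓕⁻ G) = G := FourierTransform.fourier_fourierInv_eq G
    have h2 : (𝓕 (𝓕⁻ G)) ξ = G ξ := by rw [this]
    rw [SchwartzMap.fourier_coe] at h2
    exact h2
  have e2 : ∀ ξ, VectorFourier.fourierIntegral Real.fourierChar volume (innerₗ ℝ).flip φ ξ = 0 := by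
    intro ξ
    rw [flip_innerₗ]
    exact congrFun hF ξ
  simp only [e1, e2, smul_zero, integral_zero] at key
  simpa using key

/-- Extension to the lower half-plane. -/
noncomputable def FTc (φ : ℝ → ℂ) (z : ℂ) : ℂ :=
  ∫ t : ℝ, Complex.exp (-(Complex.I * (Real.pi : ℂ) * z * (t : ℂ))) * φ t

lemma ker_norm (z : ℂ) (t : ℝ) :
    ‖Complex.exp (-(Complex.I * (Real.pi : ℂ) * z * (t : ℂ)))‖ = Real.exp (π * z.im * t) := by
  rw [Complex.norm_exp]
  congr 1
  simp

lemma ker_norm_le {φ : ℝ → ℂ} {z : ℂ} (hz : z.im ≤ 0) {t : ℝ} (ht : t < 0 → φ t = 0) :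
    ‖Complex.exp (-(Complex.I * (Real.pi : ℂ) * z * (t : ℂ))) * φ t‖ ≤ ‖φ t‖ := by
  by_cases h : t < 0
  · simp [ht h]
  · rw [norm_mul, ker_norm]
    have : π * z.im * t ≤ 0 := by
      have := mul_nonpos_of_nonpos_of_nonneg hz (not_lt.1 h)
      nlinarith [Real.pi_pos]
    exact mul_le_of_le_one_left (norm_nonneg _) (Real.exp_le_one_iff.2 this)

lemma ker_meas {φ : ℝ → ℂ} (hφ : Integrable φ) (z : ℂ) : AEStronglyMeasurable
    (fun t : ℝ => Complex.exp (-(Complex.I * (Real.pi : ℂ) * z * (t : ℂ))) * φ t) := by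
  apply AEStronglyMeasurable.mul _ hφ.1
  exact Continuous.aestronglyMeasurable (by fun_prop)

lemma FTc_norm_le {φ : ℝ → ℂ} (hφ : Integrable φ) (hs : ∀ᵐ t : ℝ, t < 0 → φ t = 0) {z : ℂ}
    (hz : z.im ≤ 0) : ‖FTc φ z‖ ≤ ∫ t, ‖φ t‖ := by
  apply norm_integral_le_of_norm_le hφ.norm
  filter_upwards [hs] with t ht using ker_norm_le hz ht

lemma FTc_cont {φ : ℝ → ℂ} (hφ : Integrable φ) (hs : ∀ᵐ t : ℝ, t < 0 → φ t = 0) :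
    ContinuousOn (FTc φ) {z | z.im ≤ 0} := by
  apply continuousOn_of_dominated (bound := fun t => ‖φ t‖)
  · intro z _; exact ker_meas hφ z
  · intro z hz
    filter_upwards [hs] with t ht using ker_norm_le hz ht
  · exact hφ.norm
  · filter_upwards with t
    exact Continuous.continuousOn (by fun_prop)

lemma FTc_diff {φ : ℝ → ℂ} (hφ : Integrable φ) (hs : ∀ᵐ t : ℝ, t < 0 → φ t = 0) {z : ℂ}
    (hz : z.im < 0) : DifferentiableAt ℂ (FTc φ) z := by
  have hopen : IsOpen {w : ℂ | w.im < z.im / 2} := isOpen_lt Complex.continuous_im continuous_const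
  have hmem : {w : ℂ | w.im < z.im / 2} ∈ nhds z := hopen.mem_nhds (by simp; linarith)
  have := hasDerivAt_integral_of_dominated_loc_of_deriv_le (μ := (volume : Measure ℝ)) 
    (F := fun (w : ℂ) (t : ℝ) => Complex.exp (-(Complex.I * (Real.pi : ℂ) * w * (t : ℂ))) * φ t)
    (F' := fun (w : ℂ) (t : ℝ) => Complex.exp (-(Complex.I * (Real.pi : ℂ) * w * (t : ℂ))) * 
      (-(Complex.I * (Real.pi : ℂ) * (t : ℂ))) * φ t)
    (bound := fun t => (2 / (-z.im)) * ‖φ t‖)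
    hmem (Filter.Eventually.of_forall fun w => ker_meas hφ w)
    (hφ.mono (ker_meas hφ z) (by filter_upwards [hs] with t ht using ker_norm_le hz.le ht))
    ?_ ?_ (hφ.norm.const_mul _) ?_
  · exact this.2.differentiableAt
  · exact (Continuous.aestronglyMeasurable (by fun_prop)).mul hφ.1
  · filter_upwards [hs] with t ht w hw
    by_cases h : t < 0
    · simp [ht h]
    have h := not_lt.1 h
    rw [norm_mul, norm_mul, ker_norm]
    apply mul_le_mul_of_nonneg_right _ (norm_nonneg _)
    have e : ‖(-(Complex.I * (Real.pi : ℂ) * (t : ℂ)))‖ = π * t := by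
      simp [abs_of_pos Real.pi_pos, abs_of_nonneg h]
    rw [e]
    have hw' : w.im < z.im / 2 := hw
    set s := π * t with hs'
    have hs0 : 0 ≤ s := by positivity
    have h1 : Real.exp (π * w.im * t) ≤ Real.exp (-(s * (-z.im / 2))) := by
      apply Real.exp_le_exp.2
      rw [hs']
      have := mul_le_mul_of_nonneg_left hw'.le hs0
      nlinarith
    have h2 := Real.add_one_le_exp (s * (-z.im / 2))
    rw [Real.exp_neg] at h1
    calc Real.exp (π * w.im * t) * s ≤ (Real.exp (s * (-z.im / 2)))⁻¹ * s := by gcongr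
      _ ≤ 2 / (-z.im) := by
        rw [inv_mul_le_iff₀ (Real.exp_pos _), mul_div_assoc', le_div_iff₀ (by linarith)]
        linarith
  · filter_upwards with t w hw
    apply HasDerivAt.mul_const
    apply HasDerivAt.cexp
    have := (((hasDerivAt_id w).const_mul (Complex.I * (Real.pi : ℂ))).mul_const (t:ℂ)).neg
    rw [mul_one] at this
    exact this

open Filter Topology Metric

/-- Möbius map from the disc to the lower half-plane. -/
noncomputable def zmap (w : ℂ) : ℂ := Complex.I * (w + 1) / (w - 1)

lemma zmap_im {w : ℂ} (hw : w ∈ ball (0:ℂ) 1) : (zmap w).im < 0 := by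
  have h1 : ‖w‖ < 1 := by simpa using hw
  have hne : w - 1 ≠ 0 := by
    intro h
    rw [sub_eq_zero.1 h] at h1
    simp at h1
  have h2 : Complex.normSq w < 1 := by
    rw [Complex.normSq_eq_norm_sq]; nlinarith [norm_nonneg w]
  have h3 : 0 < Complex.normSq (w - 1) := Complex.normSq_pos.2 hne
  have : (zmap w).im = (Complex.normSq w - 1) / Complex.normSq (w - 1) := by
    unfold zmap
    rw [Complex.div_im]
    simp only [Complex.normSq_apply, Complex.mul_im, Complex.mul_re, Complex.I_re, Complex.I_im,
      Complex.add_re, Complex.add_im, Complex.sub_re, Complex.sub_im, Complex.one_re,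
      Complex.one_im]
    ring
  rw [this]
  exact div_neg_of_neg_of_pos (by linarith) h3

lemma half_angle {θ : ℝ} (hθ : θ ∈ Set.Ioo 0 (2 * π)) :
    π / 2 - θ / 2 ∈ Set.Ioo (-(π / 2)) (π / 2) := by
  constructor <;> linarith [hθ.1, hθ.2]

lemma zmap_circle {θ : ℝ} (hθ : θ ∈ Set.Ioo 0 (2 * π)) :
    circleMap 0 1 θ - 1 ≠ 0 ∧ zmap (circleMap 0 1 θ) = (Real.tan (π / 2 - θ / 2) : ℝ) := by
  have hs : 0 < Real.sin (θ / 2) :=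
    Real.sin_pos_of_pos_of_lt_pi (by linarith [hθ.1]) (by linarith [hθ.2])
  have hs' : (Real.sin (θ / 2) : ℂ) ≠ 0 := by exact_mod_cast hs.ne'
  have e : circleMap 0 1 θ = (Real.cos (θ/2) + Real.sin (θ/2) * Complex.I) ^ 2 := by
    rw [circleMap_zero, Complex.ofReal_cos, Complex.ofReal_sin, ← Complex.exp_mul_I,
      ← Complex.exp_nat_mul]
    push_cast
    rw [one_mul]
    congr 1
    ring
  have sc : (Real.sin (θ / 2) : ℂ) ^ 2 + (Real.cos (θ / 2) : ℂ) ^ 2 = 1 := by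
    exact_mod_cast Real.sin_sq_add_cos_sq (θ / 2)
  rw [e]
  unfold zmap
  rw [Real.tan_eq_sin_div_cos, Real.sin_pi_div_two_sub, Real.cos_pi_div_two_sub]
  generalize hS : (Real.sin (θ / 2) : ℂ) = S at *
  generalize hK : (Real.cos (θ / 2) : ℂ) = K at *
  have h1 : (K + S * Complex.I) ^ 2 - 1 = 2 * Complex.I * S * (K + S * Complex.I) := by
    linear_combination (-S^2) * Complex.I_sq + sc
  have h2 : (K + S * Complex.I) ^ 2 + 1 = 2 * K * (K + S * Complex.I) := by
    linear_combination (S^2) * Complex.I_sq - sc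
  have h3 : K + S * Complex.I ≠ 0 := by
    intro h
    have : (K + S * Complex.I) * (K - S * Complex.I) = 1 := by
      linear_combination (-S^2) * Complex.I_sq + sc
    rw [h] at this
    simp at this
  rw [h1, h2]
  constructor
  · simp [hs', h3]
  · rw [Complex.ofReal_div, hS, hK]
    generalize K + S * Complex.I = Q at h3
    field_simp [Complex.I_ne_zero]

lemma boundary {φ : ℝ → ℂ} (hφ : Integrable φ) (hs : ∀ᵐ t : ℝ, t < 0 → φ t = 0)
    {θ : ℝ} (hθ : θ ∈ Set.Ioo 0 (2 * π)) :
    Tendsto (fun r : ℝ => FTc φ (zmap (circleMap 0 r θ))) (𝓝[<] 1)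
      (𝓝 (paperFT φ (Real.tan (π / 2 - θ / 2)))) := by
  obtain ⟨hne, hz⟩ := zmap_circle hθ
  have h1 : Tendsto (fun r : ℝ => zmap (circleMap 0 r θ)) (𝓝[<] 1)
      (𝓝 ((Real.tan (π / 2 - θ / 2) : ℝ) : ℂ)) := by
    rw [← hz]
    apply tendsto_nhdsWithin_of_tendsto_nhds
    have hc : ContinuousAt (fun r : ℝ => circleMap 0 r θ) 1 := by
      unfold circleMap; fun_prop
    have hm : ContinuousAt zmap (circleMap 0 1 θ) := by
      unfold zmap
      exact ContinuousAt.div (by fun_prop) (by fun_prop) hne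
    exact ContinuousAt.comp (f := fun r : ℝ => circleMap 0 r θ) hm hc
  have h2 : ContinuousWithinAt (FTc φ) {z | z.im ≤ 0} ((Real.tan (π / 2 - θ / 2) : ℝ) : ℂ) :=
    FTc_cont hφ hs _ (Complex.ofReal_im _).le
  refine Tendsto.comp (g := FTc φ) (f := fun r : ℝ => zmap (circleMap 0 r θ)) h2.tendsto (tendsto_nhdsWithin_iff.2 ⟨h1, ?_⟩)
  have : Set.Ioo (0:ℝ) 1 ∈ 𝓝[<] (1:ℝ) := Ioo_mem_nhdsLT (by norm_num)
  filter_upwards [this] with r hr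
  apply (zmap_im _).le
  simp [abs_of_pos hr.1, hr.2]

lemma tan_surj (x : ℝ) : ∃ θ ∈ Set.Ioo 0 (2 * π), Real.tan (π / 2 - θ / 2) = x := by
  refine ⟨π - 2 * Real.arctan x, ⟨?_, ?_⟩, ?_⟩
  · linarith [Real.arctan_lt_pi_div_two x]
  · linarith [Real.neg_pi_div_two_lt_arctan x]
  · rw [show π / 2 - (π - 2 * Real.arctan x) / 2 = Real.arctan x by ring, Real.tan_arctan]

lemma change_var (f : ℝ → ENNReal) :
    ∫⁻ x : ℝ, f x * ENNReal.ofReal (1 / (1 + x ^ 2)) =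
      ∫⁻ θ in Set.Ioo 0 (2 * π), ENNReal.ofReal (1 / 2) * f (Real.tan (π / 2 - θ / 2)) := by
  have himg : (fun θ => Real.tan (π / 2 - θ / 2)) '' Set.Ioo 0 (2 * π) = Set.univ := by
    ext x
    simpa using tan_surj x
  have hinj : Set.InjOn (fun θ => Real.tan (π / 2 - θ / 2)) (Set.Ioo 0 (2 * π)) := by
    intro a ha b hb hab
    have := Real.injOn_tan (half_angle ha) (half_angle hb) hab
    linarith
  rw [← setLIntegral_univ, ← himg, lintegral_image_eq_lintegral_abs_deriv_mul measurableSet_Ioo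
    (f' := fun θ => 1 / Real.cos (π / 2 - θ / 2) ^ 2 * (-(1 / 2))) _ hinj]
  · apply setLIntegral_congr_fun measurableSet_Ioo
    intro θ hθ
    have hc : 0 < Real.cos (π / 2 - θ / 2) := Real.cos_pos_of_mem_Ioo (half_angle hθ)
    simp only
    rw [mul_comm (f _), ← mul_assoc, ← ENNReal.ofReal_mul (abs_nonneg _)]
    congr 2
    rw [one_div (1 + _), Real.inv_one_add_tan_sq hc.ne', abs_mul, abs_neg,
      abs_of_pos (show (0:ℝ) < 1 / 2 by norm_num), abs_of_pos (by positivity)]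
    generalize Real.cos (π / 2 - θ / 2) = c at hc
    field_simp
  · intro θ hθ
    have hc : 0 < Real.cos (π / 2 - θ / 2) := Real.cos_pos_of_mem_Ioo (half_angle hθ)
    have h1 : HasDerivAt (fun θ : ℝ => π / 2 - θ / 2) (-(1 / 2)) θ :=
      ((hasDerivAt_id θ).div_const 2).const_sub (π / 2)
    exact ((Real.hasDerivAt_tan hc.ne').comp θ h1).hasDerivWithinAt

lemma main_lemma (φ : ℝ → ℂ) (hφ : Integrable φ) (hs : ∀ᵐ t : ℝ, t < 0 → φ t = 0)
    (h : ∫⁻ x : ℝ, negLog ‖paperFT φ x‖ * ENNReal.ofReal (1 / (1 + x ^ 2)) = ⊤) :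
    φ =ᵐ[volume] 0 := by
  set M : ℝ := max 1 (∫ t, ‖φ t‖) with hM
  have hM1 : 1 ≤ M := le_max_left _ _
  have hM0 : 0 < M := by linarith
  have hnM : ‖(M : ℂ)‖ = M := by simp [abs_of_pos hM0]
  have hMc : (M : ℂ) ≠ 0 := by exact_mod_cast hM0.ne'
  set G : ℂ → ℂ := fun w => FTc φ (zmap w) / M with hG
  have hbd : ∀ θ ∈ Set.Ioo 0 (2 * π), Tendsto (fun r : ℝ => G (circleMap 0 r θ)) (𝓝[<] 1)
      (𝓝 (paperFT φ (Real.tan (π / 2 - θ / 2)) / M)) :=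
    fun θ hθ => (boundary hφ hs hθ).div_const _
  by_cases hz : ∃ w₀ ∈ ball (0:ℂ) 1, G w₀ ≠ 0
  · exfalso
    obtain ⟨w₀, hw₀, hne⟩ := hz
    have hd : DifferentiableOn ℂ G (ball 0 1) := by
      intro w hw
      apply DifferentiableAt.differentiableWithinAt
      apply DifferentiableAt.div_const
      apply DifferentiableAt.comp w (FTc_diff hφ hs (zmap_im hw))
      unfold zmap
      apply DifferentiableAt.div (by fun_prop) (by fun_prop)
      intro h0
      rw [sub_eq_zero.1 h0] at hw
      simp at hw
    have hb : ∀ w ∈ ball (0:ℂ) 1, ‖G w‖ ≤ 1 := by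
      intro w hw
      rw [hG]
      simp only
      rw [norm_div, hnM, div_le_one hM0]
      exact (FTc_norm_le hφ hs (zmap_im hw).le).trans (le_max_right _ _)
    have key := disc_lemma G hd hb hw₀ hne _ hbd
    rw [change_var, lintegral_const_mul' _ _ ENNReal.ofReal_ne_top] at h
    apply absurd h
    apply ne_of_lt
    apply ENNReal.mul_lt_top ENNReal.ofReal_lt_top
    refine lt_of_le_of_lt (lintegral_mono fun θ => negLog_antitone ?_) key
    rw [norm_div, hnM]
    exact div_le_self (norm_nonneg _) hM1
  · push Not at hz
    apply fourier_inj φ hφ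
    intro x
    obtain ⟨θ, hθ, rfl⟩ := tan_surj x
    have h1 := hbd θ hθ
    have h2 : Tendsto (fun r : ℝ => G (circleMap 0 r θ)) (𝓝[<] 1) (𝓝 0) := by
      apply tendsto_const_nhds.congr'
      have : Set.Ioo (0:ℝ) 1 ∈ 𝓝[<] (1:ℝ) := Ioo_mem_nhdsLT (by norm_num)
      filter_upwards [this] with r hr
      rw [hz]
      simp [abs_of_pos hr.1, hr.2]
    have := tendsto_nhds_unique h1 h2
    simpa [hMc] using this

/-- If `φ ∈ L¹(ℝ)` is supported in `[0,∞)` and `∫ log|φ̂(x)|/(1+x²) dx = -∞`, then `φ = 0` a.e.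
In particular, if such a `φ` has Fourier transform vanishing on a set of positive Lebesgue
measure, then `φ = 0` a.e.  (The divergence of the logarithmic integral to `-∞` is expressed
by saying that the negative part of the integrand has infinite integral.) -/
theorem eq_zero_of_halfline_support_of_log_integral_eq_neg_infty :
    (∀ φ : ℝ → ℂ, Integrable φ → (∀ᵐ t : ℝ, t < 0 → φ t = 0) →
      (∫⁻ x : ℝ, ENNReal.ofReal (-(Real.log ‖paperFT φ x‖) / (1 + x ^ 2)) = ⊤) →
      φ =ᵐ[volume] 0)
    ∧
    (∀ φ : ℝ → ℂ, Integrable φ → (∀ᵐ t : ℝ, t < 0 → φ t = 0) →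
      ∀ E : Set ℝ, 0 < volume E → (∀ x ∈ E, paperFT φ x = 0) →
      φ =ᵐ[volume] 0) := by
  constructor
  · intro φ hφ hs h
    apply main_lemma φ hφ hs
    rw [eq_top_iff, ← h]
    apply lintegral_mono
    intro x
    simp only
    rcases eq_or_ne (paperFT φ x) 0 with h0 | h0
    · simp [h0]
    · rw [negLog_pos (norm_pos_iff.2 h0), div_eq_mul_one_div, ENNReal.ofReal_mul' (by positivity)]
  · intro φ hφ hs E hE hz
    apply main_lemma φ hφ hs
    have hsub : E ⊆ {x | negLog ‖paperFT φ x‖ * ENNReal.ofReal (1 / (1 + x ^ 2)) = ⊤} := by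
      intro x hx
      have : (0:ℝ) < 1 / (1 + x ^ 2) := by positivity
      simp only [Set.mem_ofPred_eq, hz x hx, norm_zero, negLog_zero]
      exact ENNReal.top_mul (ENNReal.ofReal_pos.2 this).ne'
    have hc : Continuous (paperFT φ) :=
      (FTc_cont hφ hs).comp_continuous Complex.continuous_ofReal (fun x => by simp)
    have hm : Measurable fun x : ℝ =>
        negLog ‖paperFT φ x‖ * ENNReal.ofReal (1 / (1 + x ^ 2)) := by
      apply Measurable.mul
      · exact (negLog_continuous.comp hc.norm).measurable
      · fun_prop
    by_contra hne
    have h0 := measure_eq_top_of_lintegral_ne_top hm.aemeasurable hne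
    exact hE.ne' (measure_mono_null hsub h0)
end

section
/- Let g ∈ L¹(ℝ) and let E ⊆ ℝ have positive Lebesgue measure. Then ∫_ℝ e^{−iπ y e^{t²}} g(t) dt = 0 for all y ∈ E if and only if g is an odd function (a.e.). -/
open MeasureTheory Real

lemma jensen_ineq (f : ℂ → ℂ) (r : ℝ) (hr : 0 < r)
    (hf : AnalyticOnNhd ℂ f (Metric.closedBall 0 |r|)) (h0 : f 0 ≠ 0) :
    Real.log ‖f 0‖ ≤ circleAverage (fun z => Real.log ‖f z‖) 0 r := by
  rw [AnalyticOnNhd.circleAverage_log_norm hr.ne' hf h0]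
  have : 0 ≤ ∑ᶠ u, (MeromorphicOn.divisor f (Metric.closedBall 0 |r|) u : ℝ)
      * Real.log (r * ‖(0:ℂ) - u‖⁻¹) := by
    apply finsum_nonneg
    intro u
    by_cases hu : u ∈ Metric.closedBall (0:ℂ) |r|
    · apply mul_nonneg
      · have := MeromorphicOn.AnalyticOnNhd.divisor_nonneg hf u
        exact_mod_cast this
      · rcases eq_or_ne u 0 with rfl | h
        · simp
        · apply Real.log_nonneg
          have hu' : ‖u‖ ≤ r := by simpa [abs_of_pos hr] using hu
          have : 0 < ‖u‖ := by simpa using h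
          rw [zero_sub, norm_neg, ← div_eq_mul_inv, le_div_iff₀ this]
          linarith
    · rw [Function.locallyFinsuppWithin.apply_eq_zero_of_notMem _ hu]
      simp
  linarith

lemma disc_uniq (f : ℂ → ℂ) (M : ℝ) (hM : 0 < M)
    (hd : DifferentiableOn ℂ f (Metric.ball 0 1))
    (hb : ∀ z ∈ Metric.closedBall (0:ℂ) 1, ‖f z‖ ≤ M)
    (hc : ∀ θ ∈ Set.Ioo 0 (2*π), ContinuousWithinAt f (Metric.closedBall 0 1) (circleMap 0 1 θ))
    (A : Set ℝ) (hA : A ⊆ Set.Ioo 0 (2*π)) (hA0 : volume A ≠ 0)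
    (hfA : ∀ θ ∈ A, f (circleMap 0 1 θ) = 0) : f 0 = 0 := by
  by_contra h0
  set h : ℝ → ℂ := fun θ => f (circleMap 0 1 θ) with hh
  have hcm : ∀ r ∈ Set.Icc (0:ℝ) 1, ∀ θ, circleMap 0 r θ ∈ Metric.closedBall (0:ℂ) 1 := by
    intro r hr θ
    simp [abs_of_nonneg hr.1, hr.2]
  have hcont : ContinuousOn h (Set.Ioo 0 (2*π)) := by
    intro θ hθ
    exact (hc θ hθ).comp (continuous_circleMap 0 1).continuousWithinAt
      (fun x _ => hcm 1 (by simp) x)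
  set Z := Set.Ioo 0 (2*π) \ (Set.Ioo 0 (2*π) ∩ h ⁻¹' {0}ᶜ) with hZ
  have hZm : MeasurableSet Z := measurableSet_Ioo.diff
    (hcont.isOpen_inter_preimage isOpen_Ioo isOpen_compl_singleton).measurableSet
  have hZs : Z ⊆ Set.Ioo 0 (2*π) := Set.sdiff_subset
  have hZ0 : ∀ θ ∈ Z, h θ = 0 := by
    intro θ hθ
    by_contra hne
    exact hθ.2 ⟨hθ.1, hne⟩
  have hAZ : A ⊆ Z := fun θ hθ => ⟨hA hθ, fun h' => h'.2 (hfA θ hθ)⟩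
  have hZfin : volume Z ≠ ⊤ := ((measure_mono hZs).trans_lt measure_Ioo_lt_top).ne
  have hZpos : 0 < volume.real Z := by
    rw [Measure.real, ENNReal.toReal_pos_iff]
    exact ⟨(pos_iff_ne_zero.2 hA0).trans_le (measure_mono hAZ), hZfin.lt_top⟩
  have hpi := Real.pi_pos
  have key : ∀ ε, 0 < ε → ε ≤ M → Real.log ‖f 0‖ ≤
      (2*π)⁻¹ * ∫ θ in (0)..(2*π), Real.log (max ‖h θ‖ ε) := by
    intro ε hε hεM
    set r : ℕ → ℝ := fun n => 1 - 1/((n:ℝ)+2) with hr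
    have hr0 : ∀ n, 0 < r n ∧ r n < 1 := by
      intro n
      have h1 : (0:ℝ) < (n:ℝ)+2 := by positivity
      have h2 : 1/((n:ℝ)+2) < 1 := by
        rw [div_lt_one h1]; linarith [Nat.cast_nonneg (α := ℝ) n]
      have h3 : 0 < 1/((n:ℝ)+2) := by positivity
      constructor <;> simp only [hr] <;> linarith
    have hrt : Filter.Tendsto r Filter.atTop (nhds 1) := by
      have : Filter.Tendsto (fun n : ℕ => 1/((n:ℝ)+2)) Filter.atTop (nhds 0) :=
        tendsto_const_nhds.div_atTop (Filter.tendsto_atTop_add_const_right _ _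
          tendsto_natCast_atTop_atTop)
      have h2 := this.const_sub 1
      rw [sub_zero] at h2
      exact h2
    have hcn : ∀ n, Continuous (fun θ => f (circleMap 0 (r n) θ)) := by
      intro n
      refine hd.continuousOn.comp_continuous (continuous_circleMap 0 _) ?_
      intro θ
      simp [abs_of_pos (hr0 n).1, (hr0 n).2]
    have hlc : ∀ n, Continuous (fun θ => Real.log (max ‖f (circleMap 0 (r n) θ)‖ ε)) := by
      intro n
      refine Continuous.log ((hcn n).norm.max continuous_const) ?_
      intro θ
      exact (lt_max_of_lt_right hε).ne'
    have hlim : Filter.Tendsto (fun n => (2*π)⁻¹ * ∫ θ in (0)..(2*π),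
        Real.log (max ‖f (circleMap 0 (r n) θ)‖ ε)) Filter.atTop
        (nhds ((2*π)⁻¹ * ∫ θ in (0)..(2*π), Real.log (max ‖h θ‖ ε))) := by
      refine Filter.Tendsto.const_mul _ ?_
      refine intervalIntegral.tendsto_integral_filter_of_dominated_convergence
        (fun _ => |Real.log ε| + |Real.log M|) ?_ ?_ ?_ ?_
      · exact Filter.Eventually.of_forall fun n => (hlc n).aestronglyMeasurable
      · refine Filter.Eventually.of_forall fun n => Filter.Eventually.of_forall fun θ _ => ?_
        have h1 : Real.log ε ≤ Real.log (max ‖f (circleMap 0 (r n) θ)‖ ε) :=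
          Real.log_le_log hε (le_max_right _ _)
        have h2 : Real.log (max ‖f (circleMap 0 (r n) θ)‖ ε) ≤ Real.log M :=
          Real.log_le_log (lt_max_of_lt_right hε)
            (max_le (hb _ (hcm _ ⟨(hr0 n).1.le, (hr0 n).2.le⟩ θ)) hεM)
        rw [Real.norm_eq_abs, abs_le]
        constructor
        · linarith [neg_abs_le (Real.log ε), abs_nonneg (Real.log M)]
        · linarith [le_abs_self (Real.log M), abs_nonneg (Real.log ε)]
      · simp
      · have hne : ∀ᵐ θ : ℝ, θ ≠ 2*π := by
          simp [ae_iff]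
        filter_upwards [hne] with θ hθ hθ'
        rw [Set.uIoc_of_le (by positivity)] at hθ'
        have hθ2 : θ ∈ Set.Ioo 0 (2*π) := ⟨hθ'.1, lt_of_le_of_ne hθ'.2 hθ⟩
        have h1 : Filter.Tendsto (fun n => circleMap 0 (r n) θ) Filter.atTop
            (nhdsWithin (circleMap 0 1 θ) (Metric.closedBall 0 1)) := by
          refine tendsto_nhdsWithin_iff.2 ⟨?_, Filter.Eventually.of_forall fun n =>
            hcm _ ⟨(hr0 n).1.le, (hr0 n).2.le⟩ θ⟩
          have : Continuous (fun x : ℝ => circleMap 0 x θ) := by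
            unfold circleMap; fun_prop
          exact (this.tendsto 1).comp hrt
        have h2 := (((hc θ hθ2).tendsto.comp h1).norm.max
          (tendsto_const_nhds (x := ε)))
        exact h2.log (lt_max_of_lt_right hε).ne'
    refine ge_of_tendsto' hlim fun n => ?_
    have han : AnalyticOnNhd ℂ f (Metric.closedBall 0 |r n|) :=
      (hd.analyticOnNhd Metric.isOpen_ball).mono
        (Metric.closedBall_subset_ball (by rw [abs_of_pos (hr0 n).1]; exact (hr0 n).2))
    refine (jensen_ineq f (r n) (hr0 n).1 han h0).trans ?_
    have hci : CircleIntegrable (fun z => Real.log ‖f z‖) 0 (r n) :=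
      (han.mono Metric.sphere_subset_closedBall).meromorphicOn.circleIntegrable_log_norm
    rw [circleAverage_def, smul_eq_mul]
    refine mul_le_mul_of_nonneg_left ?_ (by positivity)
    have hnz : ∀ᵐ θ ∂(volume.restrict (Set.Icc 0 (2*π))), f (circleMap 0 (r n) θ) ≠ 0 := by
      have h1 := han.preimage_zero_mem_codiscreteWithin (x := 0) h0 (by simp)
        (Metric.isConnected_closedBall (by simp))
      have h2 := Filter.codiscreteWithin_mono Metric.sphere_subset_closedBall h1
      have h3 := circleMap_preimage_codiscrete (hr0 n).1.ne' h2
      exact ae_restrict_le_codiscreteWithin measurableSet_Icc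
        (Filter.codiscreteWithin_mono (by tauto) h3)
    refine intervalIntegral.integral_mono_ae_restrict (by positivity) hci
      ((hlc n).intervalIntegrable _ _) ?_
    filter_upwards [hnz] with θ hz
    exact Real.log_le_log (by simpa using hz) (le_max_left _ _)
  have key2 : ∀ ε, 0 < ε → ε ≤ M → Real.log ‖f 0‖ ≤
      (2*π)⁻¹ * (2*π*Real.log M + volume.real Z * (Real.log ε - Real.log M)) := by
    intro ε hε hεM
    refine (key ε hε hεM).trans (mul_le_mul_of_nonneg_left ?_ (by positivity))
    rw [intervalIntegral.integral_of_le (by positivity), integral_Ioc_eq_integral_Ioo]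
    have hub : ∀ θ, Real.log (max ‖h θ‖ ε) ≤ Real.log M := fun θ =>
      Real.log_le_log (lt_max_of_lt_right hε) (max_le (hb _ (hcm 1 (by simp) θ)) hεM)
    have hint : IntegrableOn (fun θ => Real.log (max ‖h θ‖ ε)) (Set.Ioo 0 (2*π)) := by
      have hms : ContinuousOn (fun θ => Real.log (max ‖h θ‖ ε)) (Set.Ioo 0 (2*π)) := by
        refine ContinuousOn.log (hcont.norm.sup continuousOn_const) ?_
        intro θ _
        exact (lt_max_of_lt_right hε).ne'
      refine IntegrableOn.of_bound measure_Ioo_lt_top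
        (hms.aestronglyMeasurable measurableSet_Ioo) (|Real.log ε| + |Real.log M|) ?_
      · refine Filter.Eventually.of_forall fun θ => ?_
        have h1 : Real.log ε ≤ Real.log (max ‖h θ‖ ε) :=
          Real.log_le_log hε (le_max_right _ _)
        have h2 := hub θ
        rw [Real.norm_eq_abs, abs_le]
        constructor
        · linarith [neg_abs_le (Real.log ε), abs_nonneg (Real.log M)]
        · linarith [le_abs_self (Real.log M), abs_nonneg (Real.log ε)]
    have hi2 : IntegrableOn (Z.indicator fun _ => Real.log ε - Real.log M)
        (Set.Ioo 0 (2*π)) := by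
      apply IntegrableOn.indicator _ hZm
      exact integrableOn_const measure_Ioo_lt_top.ne
    have hi1 : IntegrableOn (fun _ => Real.log M) (Set.Ioo 0 (2*π)) :=
      integrableOn_const measure_Ioo_lt_top.ne
    calc ∫ θ in Set.Ioo 0 (2*π), Real.log (max ‖h θ‖ ε)
        ≤ ∫ θ in Set.Ioo 0 (2*π), (Real.log M +
            Z.indicator (fun _ => Real.log ε - Real.log M) θ) := by
          refine integral_mono hint (hi1.add hi2) fun θ => ?_
          by_cases hθ : θ ∈ Z
          · simp [hθ, hZ0 θ hθ, max_eq_right hε.le]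
          · simpa [hθ] using hub θ
      _ = _ := by
          rw [integral_add hi1 hi2, setIntegral_indicator hZm, Set.inter_eq_right.2 hZs]
          simp [Measure.real, ENNReal.toReal_ofReal hpi.le]
  have hlim : Filter.Tendsto (fun ε => (2*π)⁻¹ * (2*π*Real.log M + volume.real Z *
      (Real.log ε - Real.log M))) (nhdsWithin 0 (Set.Ioi 0)) Filter.atBot := by
    refine Filter.Tendsto.const_mul_atBot (by positivity) ?_
    refine Filter.tendsto_atBot_add_const_left _ _ ?_
    refine Filter.Tendsto.const_mul_atBot hZpos ?_
    exact Filter.tendsto_atBot_add_const_right _ _ Real.tendsto_log_nhdsGT_zero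
  have h1 := hlim.eventually (Filter.eventually_lt_atBot (Real.log ‖f 0‖))
  have h2 : ∀ᶠ ε in nhdsWithin (0:ℝ) (Set.Ioi 0), ε ∈ Set.Ioc 0 M :=
    Ioc_mem_nhdsGT hM
  obtain ⟨ε, h3, h4⟩ := (h1.and h2).exists
  exact absurd (key2 ε h4.1 h4.2) (not_le.2 h3)

/-- Laplace kernel. -/
noncomputable def lapK (p : ℂ) (t : ℝ) : ℂ :=
  Complex.exp (-((π : ℂ) * p * (Real.exp (t ^ 2) : ℂ)))

lemma lapK_norm (p : ℂ) (t : ℝ) : ‖lapK p t‖ = Real.exp (-(π * p.re * Real.exp (t^2))) := by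
  rw [lapK, Complex.norm_exp]
  congr 1
  simp only [Complex.neg_re, Complex.re_mul_ofReal, Complex.re_ofReal_mul]

lemma lapK_norm_le (p : ℂ) (hp : 0 ≤ p.re) (t : ℝ) : ‖lapK p t‖ ≤ 1 := by
  rw [lapK_norm, Real.exp_le_one_iff]
  have := Real.pi_pos
  have := Real.exp_pos (t^2)
  have : 0 ≤ π * p.re * Real.exp (t^2) := by positivity
  linarith

lemma lapK_cont (p : ℂ) : Continuous (lapK p) := by
  unfold lapK
  fun_prop

lemma lapK_cont' (t : ℝ) : Continuous (fun p => lapK p t) := by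
  unfold lapK
  fun_prop

lemma lap_int (g : ℝ → ℂ) (hg : Integrable g) (p : ℂ) (hp : 0 ≤ p.re) :
    Integrable (fun t => lapK p t * g t) :=
  hg.bdd_mul (c := 1) (lapK_cont p).aestronglyMeasurable
    (Filter.Eventually.of_forall fun t => lapK_norm_le p hp t)

lemma lap_bound (g : ℝ → ℂ) (hg : Integrable g) (p : ℂ) (hp : 0 ≤ p.re) :
    ‖∫ t, lapK p t * g t‖ ≤ ∫ t, ‖g t‖ := by
  refine norm_integral_le_of_norm_le hg.norm (Filter.Eventually.of_forall fun t => ?_)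
  rw [norm_mul]
  exact mul_le_of_le_one_left (norm_nonneg _) (lapK_norm_le p hp t)

lemma lap_contOn (g : ℝ → ℂ) (hg : Integrable g) :
    ContinuousOn (fun p => ∫ t, lapK p t * g t) {p : ℂ | 0 ≤ p.re} := by
  refine continuousOn_of_dominated (bound := fun t => ‖g t‖) ?_ ?_ hg.norm ?_
  · intro p hp
    exact (lap_int g hg p hp).aestronglyMeasurable
  · intro p hp
    refine Filter.Eventually.of_forall fun t => ?_
    rw [norm_mul]
    exact mul_le_of_le_one_left (norm_nonneg _) (lapK_norm_le p hp t)
  · refine Filter.Eventually.of_forall fun t => ?_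
    exact ((lapK_cont' t).mul continuous_const).continuousOn

lemma lap_diff (g : ℝ → ℂ) (hg : Integrable g) (p : ℂ) (hp : 0 < p.re) :
    DifferentiableAt ℂ (fun p => ∫ t, lapK p t * g t) p := by
  have hpi := Real.pi_pos
  have hs : {q : ℂ | p.re / 2 < q.re} ∈ nhds p :=
    (isOpen_lt continuous_const Complex.continuous_re).mem_nhds (by simp; linarith)
  refine (hasDerivAt_integral_of_dominated_loc_of_deriv_le (μ := volume)
    (F := fun p t => lapK p t * g t)
    (F' := fun p t => (lapK p t * (-((π:ℂ) * (Real.exp (t^2) : ℂ)))) * g t)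
    (bound := fun t => (2 / p.re) * ‖g t‖) hs ?_ ?_ ?_ ?_ ?_ ?_).2.differentiableAt
  · exact Filter.Eventually.of_forall fun q =>
      (lapK_cont q).aestronglyMeasurable.mul hg.aestronglyMeasurable
  · exact lap_int g hg p hp.le
  · refine AEStronglyMeasurable.mul ?_ hg.aestronglyMeasurable
    refine ((lapK_cont p).mul ?_).aestronglyMeasurable
    fun_prop
  · refine Filter.Eventually.of_forall fun t q hq => ?_
    rw [norm_mul]
    refine mul_le_mul_of_nonneg_right ?_ (norm_nonneg _)
    have hq' : p.re / 2 < q.re := hq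
    rw [norm_mul, lapK_norm, norm_neg, norm_mul, Complex.norm_real, Complex.norm_real,
      Real.norm_of_nonneg hpi.le, Real.norm_of_nonneg (Real.exp_pos _).le]
    set s := Real.exp (t^2)
    have hs0 : 0 < s := Real.exp_pos _
    have h1 : π * s * (p.re/2) ≤ Real.exp (π * q.re * s) := by
      have h2 := Real.add_one_le_exp (π * q.re * s)
      have h3 : π * s * (p.re/2) ≤ π * s * q.re :=
        mul_le_mul_of_nonneg_left hq'.le (by positivity)
      nlinarith
    rw [Real.exp_neg, inv_mul_le_iff₀ (Real.exp_pos _), mul_div_assoc', le_div_iff₀ hp]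
    linarith
  · exact hg.norm.const_mul _
  · refine Filter.Eventually.of_forall fun t q hq => ?_
    refine HasDerivAt.mul_const ?_ _
    unfold lapK
    refine HasDerivAt.cexp ?_
    have h := (((hasDerivAt_id q).const_mul (π:ℂ)).mul_const ((Real.exp (t^2) : ℝ) : ℂ)).fun_neg
    simpa using h

lemma cayley_re (w : ℂ) : ((1 + w) / (1 - w)).re = (1 - ‖w‖^2) / Complex.normSq (1 - w) := by
  rw [Complex.div_re, ← Complex.normSq_eq_norm_sq, ← add_div]
  congr 1
  simp [Complex.normSq_apply]
  ring

lemma circle_pt (u : ℝ) : circleMap 0 1 (π - 2 * Real.arctan u) =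
    -(1 - u * Complex.I) / (1 + u * Complex.I) := by
  have hne : (1 + u * Complex.I : ℂ) ≠ 0 := by
    intro h
    have := congrArg Complex.re h
    simp at this
  have hc : (Real.cos (Real.arctan u) : ℂ) ≠ 0 := by
    exact_mod_cast (Real.cos_arctan_pos u).ne'
  have hs : (Real.sin (Real.arctan u) : ℂ) = u * Real.cos (Real.arctan u) := by
    have h1 : Real.cos (Real.arctan u) ≠ 0 := (Real.cos_arctan_pos u).ne'
    have := Real.tan_mul_cos h1
    rw [Real.tan_arctan] at this
    exact_mod_cast this.symm
  have h1 : Complex.exp (Real.arctan u * Complex.I) =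
      Real.cos (Real.arctan u) * (1 + u * Complex.I) := by
    rw [Complex.exp_mul_I, ← Complex.ofReal_cos, ← Complex.ofReal_sin, hs]; ring
  have h2 : Complex.exp (-(Real.arctan u * Complex.I)) =
      Real.cos (Real.arctan u) * (1 - u * Complex.I) := by
    rw [← neg_mul, Complex.exp_mul_I, Complex.cos_neg, Complex.sin_neg,
      ← Complex.ofReal_cos, ← Complex.ofReal_sin, hs]; ring
  have h3 : circleMap 0 1 (π - 2 * Real.arctan u) =
      Complex.exp (π * Complex.I) * Complex.exp (-(Real.arctan u * Complex.I)) *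
        (Complex.exp (Real.arctan u * Complex.I))⁻¹ := by
    rw [← Complex.exp_neg, ← Complex.exp_add, ← Complex.exp_add, circleMap]
    push_cast
    rw [zero_add, one_mul]
    congr 1; ring
  rw [h3, h1, h2, Complex.exp_pi_mul_I]
  field_simp

lemma cayley_circle (u : ℝ) : (1 + circleMap 0 1 (π - 2 * Real.arctan u)) /
    (1 - circleMap 0 1 (π - 2 * Real.arctan u)) = u * Complex.I := by
  rw [circle_pt]
  have hne : (1 + u * Complex.I : ℂ) ≠ 0 := by
    intro h
    have := congrArg Complex.re h
    simp at this
  have h2 : (1 : ℂ) - -(1 - u * Complex.I) / (1 + u * Complex.I) = 2 / (1 + u * Complex.I) := by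
    field_simp; ring
  have h1 : (1 : ℂ) + -(1 - u * Complex.I) / (1 + u * Complex.I) =
      2 * (u * Complex.I) / (1 + u * Complex.I) := by
    field_simp; ring
  rw [h1, h2]
  field_simp

lemma image_pos (E : Set ℝ) (hE : volume E ≠ 0) (a b : ℝ) (ha : 0 < a) :
    volume ((fun y => π - 2 * Real.arctan ((y - b) / a)) '' E) ≠ 0 := by
  intro h
  apply hE
  have hpi := Real.pi_pos
  set A := (fun y => π - 2 * Real.arctan ((y - b) / a)) '' E
  have hd : DifferentiableOn ℝ (fun θ => b + a * Real.tan ((π - θ) / 2)) A := by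
    rintro _ ⟨y, hy, rfl⟩
    refine DifferentiableAt.differentiableWithinAt ?_
    refine DifferentiableAt.const_add _ (DifferentiableAt.const_mul ?_ _)
    refine DifferentiableAt.comp (g := Real.tan) _ ?_ (by fun_prop)
    rw [Real.differentiableAt_tan]
    have : (π - (π - 2 * Real.arctan ((y - b) / a))) / 2 = Real.arctan ((y - b) / a) := by ring
    rw [this]
    exact (Real.cos_arctan_pos _).ne'
  refine measure_mono_null ?_ (addHaar_image_eq_zero_of_differentiableOn_of_addHaar_eq_zero
    volume hd h)
  intro y hy
  refine ⟨_, ⟨y, hy, rfl⟩, ?_⟩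
  have : (π - (π - 2 * Real.arctan ((y - b) / a))) / 2 = Real.arctan ((y - b) / a) := by ring
  simp only [this, Real.tan_arctan]
  field_simp
  ring

lemma lap_zero (g : ℝ → ℂ) (hg : Integrable g) (E : Set ℝ) (hE : volume E ≠ 0)
    (hz : ∀ y ∈ E, ∫ t, lapK (y * Complex.I) t * g t = 0) (p : ℂ) (hp : 0 < p.re) :
    ∫ t, lapK p t * g t = 0 := by
  have hpi := Real.pi_pos
  set H : ℂ → ℂ := fun p => ∫ t, lapK p t * g t with hH
  set q : ℂ → ℂ := fun w => p.re * ((1 + w) / (1 - w)) + p.im * Complex.I with hq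
  have hqre : ∀ w, (q w).re = p.re * ((1 - ‖w‖^2) / Complex.normSq (1 - w)) := by
    intro w
    simp only [hq, Complex.add_re, Complex.re_ofReal_mul, cayley_re]
    simp
  have hq0 : ∀ w ∈ Metric.closedBall (0:ℂ) 1, 0 ≤ (q w).re := by
    intro w hw
    rw [hqre]
    have h1 : ‖w‖ ≤ 1 := by simpa using hw
    have : 0 ≤ 1 - ‖w‖^2 := by nlinarith [norm_nonneg w]
    have := Complex.normSq_nonneg (1 - w)
    positivity
  have hqd : ∀ w, w ≠ 1 → DifferentiableAt ℂ q w := by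
    intro w hw
    have : 1 - w ≠ 0 := sub_ne_zero.2 hw.symm
    simp only [hq]
    fun_prop (disch := assumption)
  have hq00 : q 0 = p := by
    simp [hq, Complex.re_add_im]
  have := disc_uniq (fun w => H (q w)) ((∫ t, ‖g t‖) + 1)
    (by have : 0 ≤ ∫ t, ‖g t‖ := integral_nonneg fun _ => norm_nonneg _
        linarith) ?_ ?_ ?_ ((fun y => π - 2 * Real.arctan ((y - p.im) / p.re)) '' E) ?_
    (image_pos E hE _ _ hp) ?_
  · simpa [hq00] using this
  · intro w hw
    have h1 : ‖w‖ < 1 := by simpa using hw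
    have hw1 : w ≠ 1 := by rintro rfl; simp at h1
    have h2 : 0 < (q w).re := by
      rw [hqre]
      have : 0 < 1 - ‖w‖^2 := by nlinarith [norm_nonneg w]
      have := Complex.normSq_pos.2 (sub_ne_zero.2 hw1.symm)
      positivity
    exact (DifferentiableAt.comp (g := H) w (lap_diff g hg _ h2)
      (hqd w hw1)).differentiableWithinAt
  · intro w hw
    linarith [lap_bound g hg _ (hq0 w hw)]
  · intro θ hθ
    have hne : circleMap 0 1 θ ≠ 1 := by
      intro h
      have h1 := congrArg Complex.re h
      simp [circleMap, Complex.exp_ofReal_mul_I_re] at h1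
      rw [Real.cos_eq_one_iff_of_lt_of_lt (by linarith [hθ.1]) hθ.2] at h1
      exact hθ.1.ne' h1
    have hmem : circleMap 0 1 θ ∈ Metric.closedBall (0:ℂ) 1 := by simp
    exact ContinuousWithinAt.comp (g := H) (t := {p : ℂ | 0 ≤ p.re})
      (lap_contOn g hg _ (hq0 _ hmem)) (hqd _ hne).continuousAt.continuousWithinAt
      (fun w hw => hq0 w hw)
  · rintro _ ⟨y, hy, rfl⟩
    have h1 := Real.arctan_lt_pi_div_two ((y - p.im) / p.re)
    have h2 := Real.neg_pi_div_two_lt_arctan ((y - p.im) / p.re)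
    constructor <;> dsimp only <;> linarith
  · rintro _ ⟨y, hy, rfl⟩
    have : q (circleMap 0 1 (π - 2 * Real.arctan ((y - p.im) / p.re))) = y * Complex.I := by
      simp only [hq, cayley_circle]
      have : (p.re : ℂ) ≠ 0 := by exact_mod_cast hp.ne'
      push_cast
      field_simp
      ring
    simp only [this]
    exact hz y hy

lemma four_zero (g : ℝ → ℂ) (hg : Integrable g) (E : Set ℝ) (hE : volume E ≠ 0)
    (hz : ∀ y ∈ E, ∫ t, lapK (y * Complex.I) t * g t = 0) (y : ℝ) :
    ∫ t, lapK (y * Complex.I) t * g t = 0 := by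
  have h0 : ContinuousWithinAt (fun p => ∫ t, lapK p t * g t) {p : ℂ | 0 ≤ p.re}
    (y * Complex.I) := lap_contOn g hg _ (by simp)
  have h1 : Filter.Tendsto (fun a : ℝ => (a : ℂ) + y * Complex.I)
      (nhdsWithin 0 (Set.Ioi 0)) (nhdsWithin (y * Complex.I) {p : ℂ | 0 ≤ p.re}) := by
    refine tendsto_nhdsWithin_iff.2 ⟨?_, ?_⟩
    · have : Continuous (fun a : ℝ => (a : ℂ) + y * Complex.I) := by fun_prop
      have h2 := this.tendsto 0
      simp only [Complex.ofReal_zero, zero_add] at h2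
      exact h2.mono_left nhdsWithin_le_nhds
    · filter_upwards [self_mem_nhdsWithin] with a ha
      simpa using (le_of_lt ha)
  have h2 := h0.tendsto.comp h1
  refine tendsto_nhds_unique h2 (Filter.Tendsto.congr' ?_ tendsto_const_nhds)
  filter_upwards [self_mem_nhdsWithin] with a ha
  refine (lap_zero g hg E hE hz _ ?_).symm
  simpa using ha

lemma charFun_dens (k α : ℝ → ℝ) (hk : Integrable k) (hα : Measurable α) (y : ℝ) :
    charFun ((volume.withDensity fun t => ENNReal.ofReal (k t)).map α) y =
      ∫ t, Complex.exp (y * α t * Complex.I) * ((max (k t) 0 : ℝ) : ℂ) := by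
  rw [charFun_apply_real, integral_map hα.aemeasurable (by fun_prop),
    integral_withDensity_eq_integral_toReal_smul₀ hk.aemeasurable.ennreal_ofReal
      (Filter.Eventually.of_forall fun t => ENNReal.ofReal_lt_top)]
  congr 1
  ext t
  rw [ENNReal.toReal_ofReal', Complex.real_smul, mul_comm]

lemma real_uniq (k α : ℝ → ℝ) (hk : Integrable k) (hα : Measurable α)
    (h : ∀ y : ℝ, ∫ t, Complex.exp (y * α t * Complex.I) * (k t : ℂ) = 0)
    (S : Set ℝ) (hS : MeasurableSet S) : ∫ t in α ⁻¹' S, k t = 0 := by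
  have hint : ∀ (y : ℝ) (u : ℝ → ℝ), Integrable u →
      Integrable fun t => Complex.exp (y * α t * Complex.I) * (u t : ℂ) := by
    intro y u hu
    refine hu.ofReal.bdd_mul (c := 1) ?_ ?_
    · exact Measurable.aestronglyMeasurable (by fun_prop)
    · refine Filter.Eventually.of_forall fun t => ?_
      have := Complex.norm_exp_ofReal_mul_I (y * α t)
      push_cast at this
      exact this.le
  have hfin : ∀ u : ℝ → ℝ, Integrable u →
      IsFiniteMeasure (volume.withDensity fun t => ENNReal.ofReal (u t)) := fun u hu =>
    isFiniteMeasure_withDensity_ofReal hu.2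
  have := hfin k hk
  have := hfin (fun t => - k t) hk.neg
  have heq : (volume.withDensity fun t => ENNReal.ofReal (k t)).map α =
      (volume.withDensity fun t => ENNReal.ofReal (- k t)).map α := by
    apply Measure.ext_of_charFun
    ext y
    rw [charFun_dens k α hk hα, charFun_dens (fun t => - k t) α hk.neg hα, ← sub_eq_zero,
      ← integral_sub (hint y _ hk.pos_part) (hint y (fun t => max (- k t) 0) hk.neg.pos_part), ← h y]
    congr 1
    ext t
    rw [← mul_sub, ← Complex.ofReal_sub]
    congr 2
    rcases le_total 0 (k t) with h | h
    · rw [max_eq_left h, max_eq_right (by simpa using h)]; simp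
    · rw [max_eq_right h, max_eq_left (by simpa using h)]; simp
  have h1 := congrArg (fun μ : Measure ℝ => μ S) heq
  simp only [Measure.map_apply hα hS, withDensity_apply _ (hα hS)] at h1
  rw [integral_eq_lintegral_pos_part_sub_lintegral_neg_part hk.integrableOn, h1, sub_self]

lemma cplx_uniq (g : ℝ → ℂ) (α : ℝ → ℝ) (hg : Integrable g) (hα : Measurable α)
    (h : ∀ y : ℝ, ∫ t, Complex.exp (y * α t * Complex.I) * g t = 0)
    (S : Set ℝ) (hS : MeasurableSet S) : ∫ t in α ⁻¹' S, g t = 0 := by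
  have hint : ∀ (y : ℝ) (u : ℝ → ℂ), Integrable u →
      Integrable fun t => Complex.exp (y * α t * Complex.I) * u t := by
    intro y u hu
    refine hu.bdd_mul (c := 1) ?_ ?_
    · exact Measurable.aestronglyMeasurable (by fun_prop)
    · refine Filter.Eventually.of_forall fun t => ?_
      have := Complex.norm_exp_ofReal_mul_I (y * α t)
      push_cast at this
      exact this.le
  have hgc : Integrable (fun t => (starRingEnd ℂ) (g t)) :=
    Complex.conjCLE.toContinuousLinearMap.integrable_comp hg
  have hconj : ∀ y : ℝ, ∫ t, Complex.exp (y * α t * Complex.I) * (starRingEnd ℂ) (g t) = 0 := by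
    intro y
    have h1 := congrArg (starRingEnd ℂ) (h (-y))
    rw [← integral_conj, map_zero] at h1
    rw [← h1]
    congr 1
    ext t
    rw [map_mul, ← Complex.exp_conj]
    simp
  have hre : ∫ t in α ⁻¹' S, (g t).re = 0 := by
    refine real_uniq (fun t => (g t).re) α hg.re hα (fun y => ?_) S hS
    have h2 : ∀ t, Complex.exp (y * α t * Complex.I) * ((g t).re : ℂ) =
        (1/2) * (Complex.exp (y * α t * Complex.I) * g t +
          Complex.exp (y * α t * Complex.I) * (starRingEnd ℂ) (g t)) := by
      intro t
      rw [Complex.re_eq_add_conj]; ring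
    rw [integral_congr_ae (Filter.Eventually.of_forall h2)]
    rw [integral_const_mul, integral_add (hint y _ hg) (hint y _ hgc), h, hconj]
    simp
  have him : ∫ t in α ⁻¹' S, (g t).im = 0 := by
    refine real_uniq (fun t => (g t).im) α hg.im hα (fun y => ?_) S hS
    have h2 : ∀ t, Complex.exp (y * α t * Complex.I) * ((g t).im : ℂ) =
        (1/(2 * Complex.I)) * (Complex.exp (y * α t * Complex.I) * g t -
          Complex.exp (y * α t * Complex.I) * (starRingEnd ℂ) (g t)) := by
      intro t
      rw [Complex.im_eq_sub_conj]; ring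
    rw [integral_congr_ae (Filter.Eventually.of_forall h2)]
    rw [integral_const_mul, integral_sub (hint y _ hg) (hint y _ hgc), h, hconj]
    simp
  apply Complex.ext
  · rw [← Complex.reCLM_apply, ← Complex.reCLM.integral_comp_comm hg.integrableOn]
    simpa using hre
  · rw [← Complex.imCLM_apply, ← Complex.imCLM.integral_comp_comm hg.integrableOn]
    simpa using him

lemma odd_of_sets (g : ℝ → ℂ) (hg : Integrable g)
    (h : ∀ S : Set ℝ, MeasurableSet S → ∫ t in (fun t : ℝ => Real.exp (t^2)) ⁻¹' S, g t = 0) :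
    ∀ᵐ t : ℝ, g (-t) = -g t := by
  have hgn : Integrable (fun t => g (-t)) := hg.comp_neg
  have hB : ∀ B : Set ℝ, MeasurableSet B → B ⊆ Set.Ioi 0 → ∫ t in B, (g t + g (-t)) = 0 := by
    intro B hB hB0
    have hS : MeasurableSet {x : ℝ | Real.sqrt (Real.log x) ∈ B} :=
      (by fun_prop : Measurable fun x : ℝ => Real.sqrt (Real.log x)) hB
    have h1 := h _ hS
    have hset : (fun t : ℝ => Real.exp (t^2)) ⁻¹' {x : ℝ | Real.sqrt (Real.log x) ∈ B} =
        B ∪ (fun t => -t) ⁻¹' B := by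
      ext t
      simp only [Set.mem_preimage, Set.mem_ofPred_eq, Real.log_exp, Real.sqrt_sq_eq_abs,
        Set.mem_union]
      rcases le_total 0 t with ht | ht
      · rw [abs_of_nonneg ht]
        refine ⟨Or.inl, fun h => h.elim id fun h => ?_⟩
        have := hB0 h
        simp at this
        linarith
      · rw [abs_of_nonpos ht]
        refine ⟨Or.inr, fun h => h.elim (fun h => ?_) id⟩
        have := hB0 h
        simp at this
        linarith
    have hdisj : Disjoint B ((fun t => -t) ⁻¹' B) := by
      rw [Set.disjoint_left]
      intro t h1 h2
      have h3 := hB0 h1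
      have h4 := hB0 h2
      simp at h3 h4
      linarith
    rw [hset, setIntegral_union hdisj (measurable_neg hB) hg.integrableOn hg.integrableOn] at h1
    rw [integral_add hg.integrableOn hgn.integrableOn]
    have h2 := (Measure.measurePreserving_neg (volume : Measure ℝ)).setIntegral_preimage_emb
      (MeasurableEquiv.neg ℝ).measurableEmbedding g ((fun t => -t) ⁻¹' B)
    have h3 : Neg.neg ⁻¹' ((fun t : ℝ => -t) ⁻¹' B) = B := by ext; simp
    rw [h3] at h2
    rw [h2]
    exact h1
  have hpos : ∀ᵐ t ∂(volume.restrict (Set.Ioi (0:ℝ))), g t + g (-t) = 0 := by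
    have hi : Integrable (fun t => g t + g (-t)) := hg.add hgn
    refine Integrable.ae_eq_zero_of_forall_setIntegral_eq_zero hi.restrict ?_
    intro B hBm _
    rw [Measure.restrict_restrict hBm]
    exact hB _ (hBm.inter measurableSet_Ioi) Set.inter_subset_right
  rw [ae_restrict_iff' measurableSet_Ioi] at hpos
  have hneg : ∀ᵐ t : ℝ, -t ∈ Set.Ioi (0:ℝ) → g (-t) + g (-(-t)) = 0 :=
    (Measure.measurePreserving_neg (volume : Measure ℝ)).quasiMeasurePreserving.ae hpos
  have hne : ∀ᵐ t : ℝ, t ≠ 0 := by simp [ae_iff]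
  filter_upwards [hpos, hneg, hne] with t h1 h2 h3
  rcases lt_or_gt_of_ne h3 with h | h
  · have := h2 (by simpa using h)
    rw [neg_neg] at this
    exact eq_neg_of_add_eq_zero_left this
  · exact eq_neg_of_add_eq_zero_right (h1 h)

/-- For `g ∈ L¹(ℝ)` and `E ⊆ ℝ` of positive measure:
`∫ e^{-iπ y e^{t²}} g(t) dt = 0` for all `y ∈ E` iff `g` is odd (a.e.). -/
theorem integral_exp_sq_eq_zero_iff_odd (g : ℝ → ℂ) (hg : Integrable g)
    (E : Set ℝ) (hE : 0 < volume E) :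
    (∀ y ∈ E,
      ∫ t : ℝ, Complex.exp (-(Complex.I * (Real.pi : ℂ) * (y : ℂ) * (Real.exp (t ^ 2) : ℂ)))
        * g t = 0)
    ↔ (∀ᵐ t : ℝ, g (-t) = -g t) := by
  constructor
  · intro h
    have h0 := four_zero g hg E hE.ne' (fun y hy => by
      rw [← h y hy]
      congr 1
      ext t
      rw [lapK]
      congr 3
      ring)
    refine odd_of_sets g hg (cplx_uniq g _ hg (by fun_prop) fun y => ?_)
    rw [← h0 (-y / π)]
    congr 1
    ext t
    rw [lapK]
    have : (π : ℂ) ≠ 0 := by exact_mod_cast Real.pi_ne_zero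
    congr 2
    push_cast
    field_simp
  · intro h y _
    set F : ℝ → ℂ := fun t =>
      Complex.exp (-(Complex.I * (Real.pi : ℂ) * (y : ℂ) * (Real.exp (t ^ 2) : ℂ))) * g t with hF
    have h1 : ∫ t, F (-t) = ∫ t, F t := integral_neg_eq_self F volume
    have h2 : ∫ t, F (-t) = - ∫ t, F t := by
      rw [← integral_neg]
      refine integral_congr_ae ?_
      filter_upwards [h] with t ht
      simp only [hF, ht, neg_sq, mul_neg]
    have h3 : ∫ t, F t = - ∫ t, F t := h1.symm.trans h2
    exact self_eq_neg.1 h3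
end

section
/- Let g ∈ L¹(ℝ) and let E ⊆ ℝ have positive Lebesgue measure. Then ∫_ℝ e^{−iπ x cosh t} g(t) dt = 0 for all x ∈ E if and only if g is an odd function (a.e.). -/
open MeasureTheory Real
open Filter Topology Metric

lemma aux_real_unique (ν : Measure ℝ) [SigmaFinite ν] (h c d : ℝ → ℝ) (hh : Integrable h ν)
    (hc : Measurable c) (hd : Measurable d) (hcd : ∀ᵐ t ∂ν, d (c t) = t)
    (H : ∀ s : ℝ, ∫ t, Complex.exp (s * c t * Complex.I) * (h t : ℂ) ∂ν = 0) :
    ∀ᵐ t ∂ν, h t = 0 := by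
  have hm1 : AEMeasurable (fun t => ENNReal.ofReal (h t)) ν := hh.aemeasurable.ennreal_ofReal
  have hm2 : AEMeasurable (fun t => ENNReal.ofReal (-h t)) ν := hh.neg.aemeasurable.ennreal_ofReal
  set μ1 := ν.withDensity (fun t => ENNReal.ofReal (h t)) with hμ1
  set μ2 := ν.withDensity (fun t => ENNReal.ofReal (-h t)) with hμ2
  have : IsFiniteMeasure μ1 := isFiniteMeasure_withDensity_ofReal hh.2
  have : IsFiniteMeasure μ2 := isFiniteMeasure_withDensity_ofReal hh.neg.2
  have key : μ1.map c = μ2.map c := by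
    apply Measure.ext_of_charFun
    ext s
    have hcont : Continuous (fun x : ℝ => Complex.exp (s * x * Complex.I)) := by fun_prop
    rw [charFun_apply_real, charFun_apply_real,
      integral_map hc.aemeasurable hcont.aestronglyMeasurable,
      integral_map hc.aemeasurable hcont.aestronglyMeasurable, hμ1, hμ2,
      integral_withDensity_eq_integral_toReal_smul₀ hm1 (by simp),
      integral_withDensity_eq_integral_toReal_smul₀ hm2 (by simp), ← sub_eq_zero,
      ← integral_sub, ← H s]
    · congr 1
      ext t
      rw [← sub_smul, ENNReal.toReal_ofReal', ENNReal.toReal_ofReal',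
        max_zero_sub_max_neg_zero_eq_self, Complex.real_smul, mul_comm] 
    · simp_rw [ENNReal.toReal_ofReal', Complex.real_smul]
      refine Integrable.mul_bdd (c := 1) hh.pos_part.ofReal ?_ ?_
      · exact (by fun_prop : Measurable _).aestronglyMeasurable
      · filter_upwards with t
        rw [← Complex.ofReal_mul, Complex.norm_exp_ofReal_mul_I]
    · simp_rw [ENNReal.toReal_ofReal', Complex.real_smul]
      refine Integrable.mul_bdd (c := 1) hh.neg_part.ofReal ?_ ?_
      · exact (by fun_prop : Measurable _).aestronglyMeasurable
      · filter_upwards with t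
        rw [← Complex.ofReal_mul, Complex.norm_exp_ofReal_mul_I]
  have back : ∀ μ : Measure ℝ, μ ≪ ν → (μ.map c).map d = μ := by
    intro μ hμ
    rw [Measure.map_map hd hc]
    conv_rhs => rw [← Measure.map_id (μ := μ)]
    exact Measure.map_congr (hμ.ae_le hcd)
  have e : μ1 = μ2 := by
    rw [← back μ1 (withDensity_absolutelyContinuous _ _),
      ← back μ2 (withDensity_absolutelyContinuous _ _), key]
  have := (withDensity_eq_iff_of_sigmaFinite hm1 hm2).1 e
  filter_upwards [this] with t ht
  rcases le_total 0 (h t) with h0 | h0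
  · rw [ENNReal.ofReal_of_nonpos (by linarith : -h t ≤ 0), ENNReal.ofReal_eq_zero] at ht
    linarith
  · rw [ENNReal.ofReal_of_nonpos h0, eq_comm, ENNReal.ofReal_eq_zero] at ht
    linarith

lemma aux_complex_unique (ν : Measure ℝ) [SigmaFinite ν] (h : ℝ → ℂ) (c d : ℝ → ℝ)
    (hh : Integrable h ν)
    (hc : Measurable c) (hd : Measurable d) (hcd : ∀ᵐ t ∂ν, d (c t) = t)
    (H : ∀ s : ℝ, ∫ t, Complex.exp (s * c t * Complex.I) * h t ∂ν = 0) :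
    ∀ᵐ t ∂ν, h t = 0 := by
  have hb : ∀ s : ℝ, ∀ f : ℝ → ℂ, Integrable f ν →
      Integrable (fun t => Complex.exp (s * c t * Complex.I) * f t) ν := by
    intro s f hf
    refine Integrable.bdd_mul (c := 1) hf ?_ ?_
    · exact (by fun_prop : Measurable _).aestronglyMeasurable
    · filter_upwards with t
      rw [← Complex.ofReal_mul, Complex.norm_exp_ofReal_mul_I]
  have hconj : Integrable (fun t => (starRingEnd ℂ) (h t)) ν :=
    (Complex.conjCLE : ℂ →L[ℝ] ℂ).integrable_comp hh
  have Hc : ∀ s : ℝ, ∫ t, Complex.exp (s * c t * Complex.I) * (starRingEnd ℂ) (h t) ∂ν = 0 := by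
    intro s
    have := congrArg (starRingEnd ℂ) (H (-s))
    rw [← integral_conj, map_zero] at this
    rw [← this]
    congr 1
    ext t
    rw [map_mul, ← Complex.exp_conj]
    simp
  have hre := aux_real_unique ν (fun t => (h t).re) c d hh.re hc hd hcd (by
    intro s
    have : ∀ t, Complex.exp (s * c t * Complex.I) * ((h t).re : ℂ)
      = (1/2 : ℂ) * (Complex.exp (s * c t * Complex.I) * h t
        + Complex.exp (s * c t * Complex.I) * (starRingEnd ℂ) (h t)) := by
      intro t
      rw [Complex.re_eq_add_conj]; ring
    simp_rw [this]
    rw [integral_const_mul, integral_add (hb s _ hh) (hb s _ hconj), H, Hc]; simp)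
  have him := aux_real_unique ν (fun t => (h t).im) c d hh.im hc hd hcd (by
    intro s
    have : ∀ t, Complex.exp (s * c t * Complex.I) * ((h t).im : ℂ)
      = (1/(2 * Complex.I) : ℂ) * (Complex.exp (s * c t * Complex.I) * h t
        - Complex.exp (s * c t * Complex.I) * (starRingEnd ℂ) (h t)) := by
      intro t
      rw [Complex.im_eq_sub_conj]; ring
    simp_rw [this]
    rw [integral_const_mul, integral_sub (hb s _ hh) (hb s _ hconj), H, Hc]; simp)
  filter_upwards [hre, him] with t h1 h2
  exact Complex.ext h1 h2

lemma aux_fold (g : ℝ → ℂ) (k : ℝ → ℂ) (hk : ∀ t, k (-t) = k t)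
    (hkg : Integrable (fun t => k t * g t)) :
    ∫ t in Set.Ioi (0:ℝ), k t * (g t + g (-t)) = ∫ t, k t * g t := by
  have hneg : Integrable (fun t => k t * g (-t)) := by
    simpa [hk] using hkg.comp_neg
  simp_rw [mul_add]
  rw [integral_add hkg.integrableOn hneg.integrableOn]
  have : ∫ t in Set.Ioi (0:ℝ), k t * g (-t) = ∫ t in Set.Iic (0:ℝ), k t * g t := by
    have := integral_comp_neg_Ioi (0:ℝ) (fun t => k t * g t)
    simpa [hk] using this
  rw [this, add_comm, ← Set.compl_Iic]
  exact integral_add_compl measurableSet_Iic hkg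

lemma aux_odd (g : ℝ → ℂ) (hg : Integrable g)
    (H : ∀ x : ℝ, 
      ∫ t : ℝ, Complex.exp (-(Complex.I * (Real.pi : ℂ) * (x : ℂ) * (Real.cosh t : ℂ)))
        * g t = 0) : ∀ᵐ t : ℝ, g (-t) = -g t := by
  have hI : Integrable (fun t => g t + g (-t)) := hg.add hg.comp_neg
  have := aux_complex_unique (volume.restrict (Set.Ioi 0)) (fun t => g t + g (-t))
    Real.cosh Real.arcosh hI.integrableOn Real.continuous_cosh.measurable
    (by unfold Real.arcosh; fun_prop)
    (by
      filter_upwards [ae_restrict_mem measurableSet_Ioi] with t ht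
      exact Real.arcosh_cosh (le_of_lt ht))
    (by
      intro s
      rw [aux_fold g (fun t => Complex.exp (s * Real.cosh t * Complex.I)) (by simp)]
      · rw [← H (-s / π)]
        congr 1
        ext t
        congr 2
        push_cast
        field_simp
      · refine Integrable.bdd_mul (c := 1) hg ?_ ?_
        · exact (by fun_prop : Continuous _).aestronglyMeasurable
        · filter_upwards with t
          rw [← Complex.ofReal_mul, Complex.norm_exp_ofReal_mul_I])
  rw [ae_restrict_iff' measurableSet_Ioi] at this
  have h2 : ∀ᵐ t : ℝ, -t ∈ Set.Ioi (0:ℝ) → g (-t) + g (- -t) = 0 :=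
    (Measure.measurePreserving_neg (volume : Measure ℝ)).quasiMeasurePreserving.ae this
  filter_upwards [this, h2, Measure.ae_ne volume (0:ℝ)] with t h1 h2 h3
  rcases lt_or_gt_of_ne h3 with h | h
  · have := h2 (by simpa using h)
    rw [neg_neg] at this
    exact eq_neg_of_add_eq_zero_left this
  · exact eq_neg_of_add_eq_zero_right (h1 h)

lemma aux_jensen (f : ℂ → ℂ) (r ε : ℝ) (hr : 0 < r) (hε : 0 < ε)
    (hf : AnalyticOnNhd ℂ f (closedBall 0 r)) (h0 : f 0 ≠ 0) :
    Real.log ‖f 0‖ ≤ circleAverage (fun z => Real.log (‖f z‖ + ε)) 0 r := by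
  have habs : |r| = r := abs_of_pos hr
  have hf' : AnalyticOnNhd ℂ f (closedBall 0 |r|) := by rwa [habs]
  have J := hf'.circleAverage_log_norm hr.ne' h0
  have h1 : Real.log ‖f 0‖ ≤ circleAverage (fun z => Real.log ‖f z‖) 0 r := by
    rw [J]
    have : 0 ≤ ∑ᶠ u, (MeromorphicOn.divisor f (closedBall 0 |r|) u : ℝ)
        * Real.log (r * ‖(0:ℂ) - u‖⁻¹) := by
      refine finsum_nonneg fun u => ?_
      by_cases hu : u ∈ closedBall (0:ℂ) |r|
      · refine mul_nonneg (mod_cast MeromorphicOn.AnalyticOnNhd.divisor_nonneg hf' u) ?_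
        rcases eq_or_ne u 0 with rfl | hu0
        · simp
        · apply Real.log_nonneg
          have : 0 < ‖u‖ := norm_pos_iff.2 hu0
          rw [zero_sub, norm_neg, ← div_eq_mul_inv, le_div_iff₀ this, one_mul]
          simpa [habs] using hu
      · simp [hu]
    linarith
  refine h1.trans ?_
  have hcod : f ⁻¹' {0}ᶜ ∈ codiscreteWithin (sphere (0:ℂ) |r|) :=
    codiscreteWithin_mono sphere_subset_closedBall
      (hf'.preimage_zero_mem_codiscreteWithin h0 (by simp)
      ((convex_closedBall (0:ℂ) |r|).isConnected ⟨0, by simp⟩))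
  classical
  have heq : (fun z => Real.log ‖f z‖) =ᶠ[codiscreteWithin (sphere (0:ℂ) |r|)]
      (fun z => if f z = 0 then Real.log ε else Real.log ‖f z‖) := by
    filter_upwards [hcod] with z hz
    have : f z ≠ 0 := hz
    simp [this]
  have hint : CircleIntegrable (fun z => Real.log ‖f z‖) 0 r :=
    (hf'.mono sphere_subset_closedBall).meromorphicOn.circleIntegrable_log_norm
  rw [circleAverage_congr_codiscreteWithin heq hr.ne']
  refine circleAverage_mono (hint.congr_codiscreteWithin heq) ?_ ?_
  · apply ContinuousOn.circleIntegrable hr.le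
    have : ContinuousOn f (sphere 0 r) := hf.continuousOn.mono sphere_subset_closedBall
    refine ContinuousOn.log (by fun_prop) ?_
    intro x _
    positivity
  · intro z hz
    split_ifs with h
    · simp [h]
    · exact Real.log_le_log (norm_pos_iff.2 h) (by linarith)

lemma aux_disc (f : ℂ → ℂ) (M : ℝ) (hf : DifferentiableOn ℂ f (ball 0 1))
    (hM : ∀ w ∈ ball (0:ℂ) 1, ‖f w‖ ≤ M) (b : ℝ → ℂ)
    (hb : ContinuousOn b (Set.Ioo 0 (2 * π)))
    (hlim : ∀ θ ∈ Set.Ioo 0 (2 * π),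
      Tendsto (fun r : ℝ => f (circleMap 0 r θ)) (𝓝[<] 1) (𝓝 (b θ)))
    (A : Set ℝ) (hA : MeasurableSet A) (hAs : A ⊆ Set.Ioo 0 (2 * π)) (hA0 : 0 < volume A)
    (hbA : ∀ θ ∈ A, b θ = 0) : f 0 = 0 := by
  by_contra h0
  have hM0 : 0 ≤ M := (norm_nonneg _).trans (hM 0 (by simp))
  have han : AnalyticOnNhd ℂ f (ball 0 1) := hf.analyticOnNhd isOpen_ball
  have hpi := two_pi_pos
  have hmem : ∀ r ∈ Set.Ioo (0:ℝ) 1, ∀ θ, circleMap 0 r θ ∈ ball (0:ℂ) 1 := by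
    intro r hr θ
    simp [abs_of_pos hr.1, hr.2]
  have hev : ∀ᶠ r : ℝ in 𝓝[<] 1, r ∈ Set.Ioo (0:ℝ) 1 := Ioo_mem_nhdsLT (by norm_num)
  have hbM : ∀ θ ∈ Set.Ioo 0 (2 * π), ‖b θ‖ ≤ M := by
    intro θ hθ
    refine le_of_tendsto (hlim θ hθ).norm ?_
    filter_upwards [hev] with r hr
    exact hM _ (hmem r hr θ)
  have hAfin : volume A < ⊤ := (measure_mono hAs).trans_lt measure_Ioo_lt_top
  have hAr : 0 < volume.real A := ENNReal.toReal_pos hA0.ne' hAfin.ne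
  have hlogb : ∀ ε, 0 < ε → ε < 1 → ∀ x, 0 ≤ x → x ≤ M →
      |Real.log (x + ε)| ≤ |Real.log ε| + |Real.log (M + 1)| := by
    intro ε h1 h2 x hx hxM
    have a1 : Real.log ε ≤ Real.log (x + ε) := Real.log_le_log h1 (by linarith)
    have a2 : Real.log (x + ε) ≤ Real.log (M + 1) := Real.log_le_log (by linarith) (by linarith)
    rw [abs_le]
    constructor
    · linarith [neg_abs_le (Real.log ε), abs_nonneg (Real.log (M+1))]
    · linarith [le_abs_self (Real.log (M+1)), abs_nonneg (Real.log ε)]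
  have main : ∀ ε, 0 < ε → ε < 1 → 2 * π * Real.log ‖f 0‖ ≤
      2 * π * Real.log (M + 1) + (Real.log ε - Real.log (M + 1)) * volume.real A := by
    intro ε h1 h2
    have T : Tendsto (fun r : ℝ => ∫ θ in Set.Ioo 0 (2 * π), Real.log (‖f (circleMap 0 r θ)‖ + ε))
        (𝓝[<] 1) (𝓝 (∫ θ in Set.Ioo 0 (2 * π), Real.log (‖b θ‖ + ε))) := by
      refine tendsto_integral_filter_of_dominated_convergence
        (fun _ => |Real.log ε| + |Real.log (M + 1)|) ?_ ?_ ?_ ?_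
      · filter_upwards [hev] with r hr
        have : Continuous (fun θ => f (circleMap 0 r θ)) :=
          hf.continuousOn.comp_continuous (by fun_prop) (hmem r hr)
        refine Continuous.aestronglyMeasurable (Continuous.log (this.norm.add continuous_const) ?_)
        intro x; positivity
      · filter_upwards [hev] with r hr
        filter_upwards with θ
        exact hlogb ε h1 h2 _ (norm_nonneg _) (hM _ (hmem r hr θ))
      · exact integrable_const _
      · filter_upwards [ae_restrict_mem measurableSet_Ioo] with θ hθ
        exact ((hlim θ hθ).norm.add_const ε).log (by positivity)
    have S : 2 * π * Real.log ‖f 0‖ ≤ ∫ θ in Set.Ioo 0 (2 * π), Real.log (‖b θ‖ + ε) := by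
      refine ge_of_tendsto T ?_
      filter_upwards [hev] with r hr
      have := aux_jensen f r ε hr.1 h1 (han.mono (closedBall_subset_ball hr.2)) h0
      rw [circleAverage, intervalIntegral.integral_of_le hpi.le, integral_Ioc_eq_integral_Ioo,
        smul_eq_mul, inv_mul_eq_div, le_div_iff₀ hpi] at this
      linarith
    refine S.trans ?_
    have U : ∫ θ in Set.Ioo 0 (2 * π), Real.log (‖b θ‖ + ε) ≤
        ∫ θ in Set.Ioo 0 (2 * π), (Real.log (M + 1) +
          A.indicator (fun _ => Real.log ε - Real.log (M + 1)) θ) := by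
      refine setIntegral_mono_on ?_ ?_ measurableSet_Ioo ?_
      · refine Integrable.mono' (integrable_const (|Real.log ε| + |Real.log (M + 1)|)) ?_ ?_
        · refine ContinuousOn.aestronglyMeasurable (ContinuousOn.log (by fun_prop) ?_)
            measurableSet_Ioo
          intro x _; positivity
        · filter_upwards [ae_restrict_mem measurableSet_Ioo] with θ hθ
          exact hlogb ε h1 h2 _ (norm_nonneg _) (hbM θ hθ)
      · exact (integrable_const _).add ((integrable_const _).indicator hA)
      · intro θ hθ
        by_cases h : θ ∈ A
        · simp [h, hbA θ h]
        · simp only [h, not_false_eq_true, Set.indicator_of_notMem, add_zero]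
          exact Real.log_le_log (by positivity) (by linarith [hbM θ hθ])
    refine U.trans (le_of_eq ?_)
    rw [integral_add (integrable_const _) ((integrable_const _).indicator hA),
      setIntegral_const, integral_indicator_const _ hA]
    rw [measureReal_restrict_apply hA, Set.inter_eq_left.2 hAs]
    simp [measureReal_def, smul_eq_mul, Real.volume_Ioo, pi_pos.le]
    ring
  -- choose ε
  obtain ⟨ε, hε1, hε2, hε3⟩ : ∃ ε : ℝ, 0 < ε ∧ ε < 1 ∧
      Real.log ε < (2 * π * Real.log ‖f 0‖ - 2 * π * Real.log (M + 1)) / volume.real A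
        + Real.log (M + 1) := by
    have := (tendsto_log_nhdsGT_zero).eventually_lt_atBot
      ((2 * π * Real.log ‖f 0‖ - 2 * π * Real.log (M + 1)) / volume.real A + Real.log (M + 1))
    obtain ⟨ε, h1, h2⟩ := (this.and (Ioo_mem_nhdsGT (by norm_num : (0:ℝ) < 1))).exists
    exact ⟨ε, h2.1, h2.2, h1⟩
  have := main ε hε1 hε2
  have h3 : (Real.log ε - Real.log (M + 1)) <
    (2 * π * Real.log ‖f 0‖ - 2 * π * Real.log (M + 1)) / volume.real A := by linarith
  rw [lt_div_iff₀ hAr] at h3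
  linarith

lemma aux_cayley_im (w : ℂ) (hw : ‖w‖ < 1) : (-Complex.I * (1 + w) / (1 - w)).im < 0 := by
  have h1 : 1 - w ≠ 0 := by
    intro h
    have : w = 1 := by linear_combination -h
    simp [this] at hw
  have h2 : 0 < Complex.normSq (1 - w) := Complex.normSq_pos.2 h1
  have h3 : w.re * w.re + w.im * w.im < 1 := by
    have := Complex.normSq_eq_norm_sq w
    rw [Complex.normSq_apply] at this
    nlinarith [norm_nonneg w]
  rw [Complex.div_im, ← sub_div]
  apply div_neg_of_neg_of_pos _ h2
  simp
  nlinarith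

lemma aux_cayley_circle (θ : ℝ) (hθ : θ ∈ Set.Ioo 0 (2 * π)) :
    1 - circleMap 0 1 θ ≠ 0 ∧ -Complex.I * (1 + circleMap 0 1 θ) / (1 - circleMap 0 1 θ)
      = ((Real.cos (θ / 2) / Real.sin (θ / 2) : ℝ) : ℂ) := by
  have hs : 0 < Real.sin (θ / 2) := Real.sin_pos_of_pos_of_lt_pi (by linarith [hθ.1])
    (by linarith [hθ.2])
  have e : circleMap 0 1 θ = (Real.cos (θ / 2) + Real.sin (θ / 2) * Complex.I) ^ 2 := by
    rw [circleMap_zero, Complex.ofReal_cos, Complex.ofReal_sin, ← Complex.exp_mul_I,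
      ← Complex.exp_nat_mul]
    push_cast
    rw [one_mul]
    congr 1
    ring
  have hn : (Real.cos (θ / 2) + Real.sin (θ / 2) * Complex.I : ℂ) ≠ 0 := by
    intro h
    have := congrArg Complex.im h
    rw [Complex.add_im, Complex.ofReal_im, Complex.im_ofReal_mul, Complex.I_im, Complex.zero_im,
      mul_one, zero_add] at this
    exact hs.ne' this
  have hsc : (Real.sin (θ / 2) : ℂ) ≠ 0 := by exact_mod_cast hs.ne'
  have cs : (Real.sin (θ / 2) : ℂ) ^ 2 + (Real.cos (θ / 2) : ℂ) ^ 2 = 1 := by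
    exact_mod_cast Real.sin_sq_add_cos_sq (θ / 2)
  rw [e]
  push_cast
  push_cast at hn hsc cs
  generalize Complex.sin (θ / 2) = s at *
  generalize Complex.cos (θ / 2) = c at *
  have d1 : 1 - (c + s * Complex.I) ^ 2 = -2 * Complex.I * s * (c + s * Complex.I) := by
    linear_combination -cs + s ^ 2 * Complex.I_sq
  have d2 : 1 + (c + s * Complex.I) ^ 2 = 2 * c * (c + s * Complex.I) := by
    linear_combination -cs + s ^ 2 * Complex.I_sq
  have hd : -2 * Complex.I * s * (c + s * Complex.I) ≠ 0 := by
    simp [hsc, hn]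
  rw [d1, d2]
  refine ⟨hd, ?_⟩
  rw [div_eq_div_iff hd hsc]
  ring

lemma aux_halfplane (F : ℂ → ℂ) (M : ℝ) (hFc : ContinuousOn F {z | z.im ≤ 0})
    (hFd : DifferentiableOn ℂ F {z | z.im < 0}) (hM : ∀ z : ℂ, z.im ≤ 0 → ‖F z‖ ≤ M)
    (E : Set ℝ) (hE : 0 < volume E) (hFE : ∀ x ∈ E, F (x : ℂ) = 0) (z₀ : ℂ) (hz₀ : z₀.im < 0) :
    F z₀ = 0 := by
  set p : ℝ := z₀.re
  set q : ℝ := -z₀.im with hq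
  have hq0 : 0 < q := by linarith
  set φ : ℂ → ℂ := fun w => p + q * (-Complex.I * (1 + w) / (1 - w)) with hφ
  set τ : ℝ → ℝ := fun θ => p + q * (Real.cos (θ / 2) / Real.sin (θ / 2)) with hτ
  have hsin : ∀ θ ∈ Set.Ioo 0 (2 * π), Real.sin (θ / 2) ≠ 0 := fun θ hθ =>
    (Real.sin_pos_of_pos_of_lt_pi (by linarith [hθ.1]) (by linarith [hθ.2])).ne'
  have hφim : ∀ w : ℂ, ‖w‖ < 1 → (φ w).im < 0 := by
    intro w hw
    have := aux_cayley_im w hw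
    have e : (φ w).im = q * (-Complex.I * (1 + w) / (1 - w)).im := by
      simp only [hφ, Complex.add_im, Complex.ofReal_im, Complex.im_ofReal_mul, zero_add]
    rw [e]
    exact mul_neg_of_pos_of_neg hq0 this
  have hφτ : ∀ θ ∈ Set.Ioo 0 (2 * π), φ (circleMap 0 1 θ) = (τ θ : ℂ) := by
    intro θ hθ
    simp only [hφ, hτ]
    rw [(aux_cayley_circle θ hθ).2]
    push_cast
    rfl
  have hne : ∀ w ∈ ball (0:ℂ) 1, 1 - w ≠ 0 := by
    intro w hw h
    have : w = 1 := by linear_combination -h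
    simp [this] at hw
  have hφ0 : φ 0 = z₀ := by
    apply Complex.ext <;> simp [hφ, hq, p]
  have hτd : DifferentiableOn ℝ τ (Set.Ioo 0 (2 * π)) := by
    intro θ hθ
    have := hsin θ hθ
    apply DifferentiableAt.differentiableWithinAt
    simp only [hτ]
    fun_prop (disch := assumption)
  have hbc : ContinuousOn (fun θ => F (τ θ : ℂ)) (Set.Ioo 0 (2 * π)) := by
    refine hFc.comp (Complex.continuous_ofReal.comp_continuousOn hτd.continuousOn) ?_
    intro θ _
    simp
  set A : Set ℝ := Set.Ioo 0 (2 * π) \ (Set.Ioo 0 (2 * π) ∩ (fun θ => F (τ θ : ℂ)) ⁻¹' {0}ᶜ)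
    with hA
  have hAmem : ∀ θ, θ ∈ A ↔ θ ∈ Set.Ioo 0 (2 * π) ∧ F (τ θ : ℂ) = 0 := by
    intro θ
    simp only [hA, Set.mem_sdiff, Set.mem_inter_iff, Set.mem_preimage, Set.mem_compl_iff,
      Set.mem_singleton_iff]
    tauto
  have hAmeas : MeasurableSet A := measurableSet_Ioo.diff
    (hbc.isOpen_inter_preimage isOpen_Ioo isOpen_compl_singleton).measurableSet
  rw [← hφ0]
  refine aux_disc (fun w => F (φ w)) M ?_ ?_ (fun θ => F (τ θ : ℂ)) hbc ?_ A hAmeas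
    (fun θ hθ => ((hAmem θ).1 hθ).1) ?_ (fun θ hθ => ((hAmem θ).1 hθ).2)
  · refine hFd.comp ?_ ?_
    · intro w hw
      have := hne w hw
      apply DifferentiableAt.differentiableWithinAt
      simp only [hφ]
      fun_prop (disch := assumption)
    · intro w hw
      exact hφim w (by simpa using hw)
  · intro w hw
    exact hM _ (hφim w (by simpa using hw)).le
  · intro θ hθ
    have hc : ContinuousAt (fun r : ℝ => φ (circleMap 0 r θ)) 1 := by
      have := (aux_cayley_circle θ hθ).1
      have hcm : ContinuousAt (fun r : ℝ => circleMap 0 r θ) 1 := by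
        simp only [circleMap]; fun_prop
      simp only [hφ]
      refine continuousAt_const.add (continuousAt_const.mul
        (ContinuousAt.div ?_ ?_ this))
      · exact continuousAt_const.mul (continuousAt_const.add hcm)
      · exact continuousAt_const.sub hcm
    have hc' : Tendsto (fun r : ℝ => φ (circleMap 0 r θ)) (𝓝[<] 1)
        (𝓝[{z | z.im ≤ 0}] (τ θ : ℂ)) := by
      rw [tendsto_nhdsWithin_iff]
      constructor
      · rw [← hφτ θ hθ]
        exact hc.tendsto.mono_left nhdsWithin_le_nhds
      · filter_upwards [Ioo_mem_nhdsLT (by norm_num : (0:ℝ) < 1)] with r hr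
        refine (hφim _ ?_).le
        simp [abs_of_pos hr.1, hr.2]
    exact (hFc (τ θ : ℂ) (by simp)).tendsto.comp hc'
  · rw [pos_iff_ne_zero]
    intro h
    have h2 := addHaar_image_eq_zero_of_differentiableOn_of_addHaar_eq_zero volume
      (hτd.mono (fun θ hθ => ((hAmem θ).1 hθ).1)) h
    refine hE.ne' (measure_mono_null ?_ h2)
    intro x hx
    have b1 := Real.arctan_lt_pi_div_two ((x - p) / q)
    have b2 := Real.neg_pi_div_two_lt_arctan ((x - p) / q)
    have hx' : τ (π - 2 * Real.arctan ((x - p) / q)) = x := by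
      simp only [hτ]
      rw [show (π - 2 * Real.arctan ((x - p) / q)) / 2 = π / 2 - Real.arctan ((x - p) / q) by ring,
        Real.cos_pi_div_two_sub, Real.sin_pi_div_two_sub, ← Real.tan_eq_sin_div_cos,
        Real.tan_arctan]
      field_simp
      ring
    refine ⟨_, (hAmem _).2 ⟨⟨by linarith, by linarith⟩, ?_⟩, hx'⟩
    rw [hx']
    exact hFE x hx

lemma aux_kernel_norm (z : ℂ) (t : ℝ) :
    ‖Complex.exp (-(Complex.I * (Real.pi : ℂ) * z * (Real.cosh t : ℂ)))‖
      = Real.exp (π * Real.cosh t * z.im) := by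
  rw [Complex.norm_exp]
  congr 1
  rw [show -(Complex.I * (Real.pi : ℂ) * z * (Real.cosh t : ℂ))
    = ((π * Real.cosh t : ℝ) : ℂ) * (-(Complex.I * z)) by push_cast; ring, Complex.re_ofReal_mul]
  simp

lemma aux_kernel_le (z : ℂ) (hz : z.im ≤ 0) (t : ℝ) :
    ‖Complex.exp (-(Complex.I * (Real.pi : ℂ) * z * (Real.cosh t : ℂ)))‖ ≤ 1 := by
  rw [aux_kernel_norm, Real.exp_le_one_iff]
  exact mul_nonpos_of_nonneg_of_nonpos (mul_nonneg pi_pos.le (Real.cosh_pos t).le) hz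

lemma aux_bound (g : ℝ → ℂ) (z : ℂ) (hz : z.im ≤ 0) (t : ℝ) :
    ‖Complex.exp (-(Complex.I * (Real.pi : ℂ) * z * (Real.cosh t : ℂ))) * g t‖ ≤ ‖g t‖ := by
  rw [norm_mul]
  exact mul_le_of_le_one_left (norm_nonneg _) (aux_kernel_le z hz t)

lemma aux_meas (g : ℝ → ℂ) (hg : Integrable g) (z : ℂ) :
    AEStronglyMeasurable (fun t : ℝ =>
      Complex.exp (-(Complex.I * (Real.pi : ℂ) * z * (Real.cosh t : ℂ))) * g t) := by
  have h : Continuous (fun t : ℝ =>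
      Complex.exp (-(Complex.I * (Real.pi : ℂ) * z * (Real.cosh t : ℂ)))) := by fun_prop
  exact h.aestronglyMeasurable.mul hg.aestronglyMeasurable

lemma aux_diff (g : ℝ → ℂ) (hg : Integrable g) (z₀ : ℂ) (hz₀ : z₀.im < 0) :
    DifferentiableAt ℂ (fun z : ℂ => ∫ t : ℝ,
      Complex.exp (-(Complex.I * (Real.pi : ℂ) * z * (Real.cosh t : ℂ))) * g t) z₀ := by
  set δ : ℝ := -z₀.im / 2 with hδ
  have hδ0 : 0 < δ := by linarith
  have hball : ∀ z ∈ ball z₀ δ, z.im ≤ -δ := by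
    intro z hz
    have h1 : |(z - z₀).im| < δ :=
      (Complex.abs_im_le_norm _).trans_lt (by simpa [dist_eq_norm] using hz)
    rw [Complex.sub_im] at h1
    have := (abs_lt.1 h1).2
    linarith
  have := hasDerivAt_integral_of_dominated_loc_of_deriv_le (𝕜 := ℂ) (μ := volume)
    (F := fun (z : ℂ) (t : ℝ) =>
      Complex.exp (-(Complex.I * (Real.pi : ℂ) * z * (Real.cosh t : ℂ))) * g t)
    (F' := fun (z : ℂ) (t : ℝ) =>
      (-(Complex.I * (Real.pi : ℂ) * (Real.cosh t : ℂ))) * 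
      (Complex.exp (-(Complex.I * (Real.pi : ℂ) * z * (Real.cosh t : ℂ))) * g t))
    (x₀ := z₀) (s := ball z₀ δ) (bound := fun t => δ⁻¹ * ‖g t‖)
    (ball_mem_nhds z₀ hδ0) (Eventually.of_forall fun z => aux_meas g hg z)
    (hg.mono (aux_meas g hg z₀) (Eventually.of_forall fun t => aux_bound g z₀ hz₀.le t))
    (by
      have h : Continuous (fun t : ℝ => (-(Complex.I * (Real.pi : ℂ) * (Real.cosh t : ℂ)))) := by
        fun_prop
      exact h.aestronglyMeasurable.mul (aux_meas g hg z₀))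
    (by
      filter_upwards with t z hz
      rw [norm_mul, norm_mul, ← mul_assoc, aux_kernel_norm]
      gcongr
      have hn : ‖-(Complex.I * (Real.pi : ℂ) * (Real.cosh t : ℂ))‖ = π * Real.cosh t := by
        rw [norm_neg, norm_mul, norm_mul, Complex.norm_I, one_mul, Complex.norm_real,
          Complex.norm_real, Real.norm_of_nonneg pi_pos.le, Real.norm_of_nonneg (Real.cosh_pos t).le]
      rw [hn]
      have hy : 0 < π * Real.cosh t := mul_pos pi_pos (Real.cosh_pos t)
      generalize π * Real.cosh t = y at *
      have h1 : Real.exp (y * z.im) ≤ Real.exp (-(y * δ)) := by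
        apply Real.exp_le_exp.2
        nlinarith [hball z hz]
      have h2 : y * δ ≤ Real.exp (y * δ) := by linarith [Real.add_one_le_exp (y * δ)]
      calc y * Real.exp (y * z.im) ≤ y * Real.exp (-(y * δ)) := by gcongr
        _ ≤ δ⁻¹ := by
          rw [Real.exp_neg, ← div_eq_mul_inv, div_le_iff₀ (Real.exp_pos _), inv_mul_eq_div,
            le_div_iff₀ hδ0]
          exact h2)
    (hg.norm.const_mul _)
    (by
      filter_upwards with t z hz
      have h1 : HasDerivAt (fun z : ℂ => -(Complex.I * (Real.pi : ℂ) * z * (Real.cosh t : ℂ)))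
          (-(Complex.I * (Real.pi : ℂ) * (Real.cosh t : ℂ))) z := by
        have := (((hasDerivAt_id z).const_mul (Complex.I * (Real.pi : ℂ))).mul_const
          (Real.cosh t : ℂ)).neg
        rw [mul_one] at this
        exact this
      have h2 := (h1.cexp).mul_const (g t)
      refine h2.congr_deriv ?_
      ring)
  exact this.2.differentiableAt

/-- For `g ∈ L¹(ℝ)` and `E ⊆ ℝ` of positive measure:
`∫ e^{-iπ x cosh t} g(t) dt = 0` for all `x ∈ E` iff `g` is odd (a.e.). -/
theorem integral_exp_cosh_eq_zero_iff_odd (g : ℝ → ℂ) (hg : Integrable g)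
    (E : Set ℝ) (hE : 0 < volume E) :
    (∀ x ∈ E,
      ∫ t : ℝ, Complex.exp (-(Complex.I * (Real.pi : ℂ) * (x : ℂ) * (Real.cosh t : ℂ)))
        * g t = 0)
    ↔ (∀ᵐ t : ℝ, g (-t) = -g t) := by
  constructor
  · intro H
    apply aux_odd g hg
    set F : ℂ → ℂ := fun z => ∫ t : ℝ,
      Complex.exp (-(Complex.I * (Real.pi : ℂ) * z * (Real.cosh t : ℂ))) * g t with hF
    have hFc : ContinuousOn F {z | z.im ≤ 0} := by
      refine continuousOn_of_dominated (bound := fun t => ‖g t‖)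
        (fun z _ => aux_meas g hg z) ?_ hg.norm ?_
      · intro z hz
        filter_upwards with t
        exact aux_bound g z hz t
      · filter_upwards with t
        fun_prop
    have hF0 := aux_halfplane F (∫ t, ‖g t‖) hFc
      (fun z hz => (aux_diff g hg z hz).differentiableWithinAt)
      (fun z hz => norm_integral_le_of_norm_le hg.norm
        (Eventually.of_forall fun t => aux_bound g z hz t)) E hE H
    intro x
    have T : Tendsto (fun y : ℝ => F ((x : ℂ) - y * Complex.I)) (𝓝[>] 0) (𝓝 (F (x : ℂ))) := by
      refine (hFc (x : ℂ) (by simp)).tendsto.comp ?_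
      rw [tendsto_nhdsWithin_iff]
      constructor
      · have : Continuous (fun y : ℝ => (x : ℂ) - y * Complex.I) := by fun_prop
        have h := this.tendsto 0
        simp only [Complex.ofReal_zero, zero_mul, sub_zero] at h
        exact h.mono_left nhdsWithin_le_nhds
      · filter_upwards [self_mem_nhdsWithin] with y hy
        simpa using le_of_lt hy
    refine tendsto_nhds_unique T (tendsto_const_nhds.congr' ?_)
    filter_upwards [self_mem_nhdsWithin] with y hy
    exact (hF0 _ (by simpa using hy)).symm
  · intro H x _
    have h := integral_neg_eq_self (fun t : ℝ =>
      Complex.exp (-(Complex.I * (Real.pi : ℂ) * (x : ℂ) * (Real.cosh t : ℂ))) * g t) volume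
    have h2 : ∫ t : ℝ, Complex.exp (-(Complex.I * (Real.pi : ℂ) * (x : ℂ) * (Real.cosh (-t) : ℂ)))
        * g (-t) = ∫ t : ℝ,
        -(Complex.exp (-(Complex.I * (Real.pi : ℂ) * (x : ℂ) * (Real.cosh t : ℂ))) * g t) := by
      apply integral_congr_ae
      filter_upwards [H] with t ht
      rw [ht, Real.cosh_neg, mul_neg]
    rw [h2, integral_neg] at h
    exact self_eq_neg.1 h.symm
end

section
/- Let g ∈ L¹[0,∞) and suppose ∫₀^∞ e^{−iπ cosh(t−s)} g(t) dt = 0 for all s ∈ ℝ. Then g = 0 a.e. (Heisenberg uniqueness: the hyperbola branch Γ = {(cosh t, sinh t) : t ≥ 0} paired with Λ = {(cosh s, −sinh s) : s ∈ ℝ} is a Heisenberg uniqueness pair.) -/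
open MeasureTheory Real

lemma hup_fourier_inj (f : ℝ → ℂ) (hf : Integrable f)
    (h : ∀ η : ℝ, ∫ x : ℝ, Complex.exp (-(Complex.I * η * x)) * f x = 0) :
    ∀ᵐ x, f x = 0 := by
  open FourierTransform in
  have hF : ∀ ξ : ℝ, 𝓕 f ξ = 0 := by
    intro ξ
    rw [Real.fourier_eq']
    rw [← h (2 * π * ξ)]
    congr 1; ext x
    simp only [smul_eq_mul]
    congr 2
    simp
    ring
  apply ae_eq_zero_of_integral_contDiff_smul_eq_zero hf.locallyIntegrable
  intro φ hφ hs
  open FourierTransform in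
  have hs' : HasCompactSupport (fun x => (φ x : ℂ)) := hs.comp_left (g := fun r : ℝ => (r : ℂ)) (by simp)
  have hφ' : ContDiff ℝ (⊤ : ℕ∞) (fun x => (φ x : ℂ)) := Complex.ofRealCLM.contDiff.comp hφ
  let Ψ : SchwartzMap ℝ ℂ := hs'.toSchwartzMap hφ'
  open FourierTransform in
  have key := VectorFourier.integral_fourierIntegral_smul_eq_flip (L := innerₗ ℝ) (μ := volume) (ν := volume)
      Real.continuous_fourierChar continuous_inner hf (𝓕⁻ Ψ).integrable
  open FourierTransform in
  have e1 : ∀ x, 𝓕 ((𝓕⁻ Ψ : SchwartzMap ℝ ℂ) : ℝ → ℂ) x = φ x := by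
    intro x
    rw [← SchwartzMap.fourier_coe, FourierTransform.fourier_fourierInv_eq]
    rfl
  have e2 : ∀ ξ, VectorFourier.fourierIntegral Real.fourierChar volume (innerₗ ℝ) f ξ = 0 := hF
  simp only [e2, zero_smul, integral_zero] at key
  rw [flip_innerₗ] at key
  rw [key]
  congr 1; ext x
  rw [Complex.real_smul, smul_eq_mul, mul_comm]
  congr 1
  exact (e1 x).symm

lemma hup_int_pow (n : ℕ) (l : ℂ) (hl : 0 < l.re) :
    IntegrableOn (fun u : ℝ => (u : ℂ) ^ n * Complex.exp (-l * u)) (Set.Ioi 0) := by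
  have h0 := integrableOn_rpow_mul_exp_neg_mul_rpow (s := n) (p := 1) (b := l.re)
    (by have : (0:ℝ) ≤ n := n.cast_nonneg
        linarith) one_pos hl
  refine Integrable.mono' h0 (by fun_prop) ?_
  filter_upwards [ae_restrict_mem measurableSet_Ioi] with u hu
  have hu : 0 < u := hu
  simp [Complex.norm_exp, abs_of_pos hu]

lemma hup_gamma (n : ℕ) (l : ℂ) (hl : 0 < l.re) :
    ∫ u in Set.Ioi (0:ℝ), (u : ℂ) ^ n * Complex.exp (-l * u) = n.factorial / l ^ (n + 1) := by
  have hl0 : l ≠ 0 := by rintro rfl; simp at hl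
  have ht : ∀ n : ℕ, Filter.Tendsto (fun u : ℝ => (u : ℂ) ^ n * Complex.exp (-l * u)) Filter.atTop (nhds 0) := by
    intro n
    have := tendsto_rpow_mul_exp_neg_mul_atTop_nhds_zero n l.re hl
    rw [tendsto_zero_iff_norm_tendsto_zero]
    refine this.congr' ?_
    filter_upwards [Filter.eventually_gt_atTop 0] with u hu
    simp [Complex.norm_exp, abs_of_pos hu]
  have hd : ∀ u : ℝ, HasDerivAt (fun u : ℝ => Complex.exp (-l * u)) (-l * Complex.exp (-l * u)) u := by
    intro u
    have h1 : HasDerivAt (fun u : ℝ => -l * (u:ℂ)) (-l * 1) u :=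
      (Complex.ofRealCLM.hasDerivAt (x := u)).const_mul (-l)
    convert h1.cexp using 1
    ring
  induction n with
  | zero =>
    have := integral_Ioi_of_hasDerivAt_of_tendsto (a := 0) (f := fun u : ℝ => (-l)⁻¹ * Complex.exp (-l * u))
      (f' := fun u : ℝ => Complex.exp (-l * u)) (m := 0) (by fun_prop)
      (fun u _ => by
        refine ((hd u).const_mul (-l)⁻¹).congr_deriv ?_
        rw [inv_mul_cancel_left₀ (neg_ne_zero.2 hl0)])
      (by simpa using hup_int_pow 0 l hl)
      (by simpa using (ht 0).const_mul (-l)⁻¹)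
    simpa using this
  | succ n ih =>
    have hd2 : ∀ u : ℝ, HasDerivAt (fun u : ℝ => (u:ℂ) ^ (n+1) * Complex.exp (-l * u))
        ((n+1) * ((u:ℂ)^n * Complex.exp (-l * u)) - l * ((u:ℂ) ^ (n+1) * Complex.exp (-l * u))) u := by
      intro u
      have h1 : HasDerivAt (fun u : ℝ => (u:ℂ)) 1 u := Complex.ofRealCLM.hasDerivAt (x := u)
      refine ((h1.pow (n+1)).mul (hd u)).congr_deriv ?_
      simp
      ring
    have i1 := (hup_int_pow n l hl).const_mul ((n:ℂ)+1)
    have i2 := (hup_int_pow (n+1) l hl).const_mul l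
    have := integral_Ioi_of_hasDerivAt_of_tendsto (a := 0) (m := 0)
      (f := fun u : ℝ => (u:ℂ) ^ (n+1) * Complex.exp (-l * u)) (by fun_prop)
      (fun u _ => hd2 u) (i1.sub i2) (ht (n+1))
    rw [integral_sub i1 i2, integral_const_mul, integral_const_mul, ih] at this
    simp only [Complex.ofReal_zero, ne_eq, Nat.add_eq_zero_iff, one_ne_zero, and_false, not_false_eq_true, zero_pow, zero_mul, sub_zero] at this
    have h3 := (sub_eq_zero.1 this).symm
    rw [eq_div_iff (by positivity)]
    rw [Nat.factorial_succ]
    push_cast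
    rw [mul_div_assoc', eq_div_iff (by positivity)] at h3
    rw [← h3]; ring

/-- The Bessel-type kernel. -/
noncomputable def hupK (b u : ℝ) : ℝ := ∑' n : ℕ, b ^ (n+1) * u ^ n / ((n+1).factorial * n.factorial)

lemma hupK_summable (b u : ℝ) : Summable (fun n : ℕ => b ^ (n+1) * u ^ n / ((n+1).factorial * n.factorial : ℝ)) := by
  refine Summable.of_norm_bounded (g := fun n : ℕ => |b| * (|b * u| ^ n / n.factorial))
    ((Real.summable_pow_div_factorial _).mul_left _) ?_
  intro n
  have h1 : (1:ℝ) ≤ (n+1).factorial := by exact_mod_cast Nat.one_le_iff_ne_zero.2 (Nat.factorial_ne_zero _)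
  have h2 : (0:ℝ) < n.factorial := by positivity
  rw [norm_div, Real.norm_eq_abs, Real.norm_eq_abs, abs_mul, abs_pow, abs_pow, abs_mul b u, mul_pow,
    abs_of_pos (by positivity : (0:ℝ) < (n+1).factorial * n.factorial), mul_div_assoc']
  rw [show |b| ^ (n+1) * |u| ^ n = |b| * (|b| ^ n * |u| ^ n) by ring]
  gcongr
  nlinarith

lemma hupK_nonneg {b u : ℝ} (hb : 0 ≤ b) (hu : 0 ≤ u) : 0 ≤ hupK b u :=
  tsum_nonneg fun n => by positivity

lemma hupK_measurable : Measurable (fun p : ℝ × ℝ => hupK p.1 p.2) := by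
  refine measurable_of_tendsto_metrizable (f := fun (N : ℕ) (p : ℝ × ℝ) => ∑ n ∈ Finset.range N, p.1 ^ (n+1) * p.2 ^ n / ((n+1).factorial * n.factorial : ℝ)) (fun N => by fun_prop) ?_
  rw [tendsto_pi_nhds]
  intro p
  exact (hupK_summable p.1 p.2).hasSum.tendsto_sum_nat

lemma hupK_laplace {b : ℝ} (hb : 0 ≤ b) (l : ℂ) (hl : 0 < l.re) :
    ∫ u in Set.Ioi (0:ℝ), (hupK b u : ℂ) * Complex.exp (-l * u) = Complex.exp (b / l) - 1 := by
  have hl0 : l ≠ 0 := by rintro rfl; simp at hl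
  set c : ℕ → ℝ := fun n => b ^ (n+1) / ((n+1).factorial * n.factorial : ℝ) with hc
  have hc0 : ∀ n, 0 ≤ c n := fun n => by positivity
  let F : ℕ → ℝ → ℂ := fun n u => (c n : ℂ) * ((u : ℂ) ^ n * Complex.exp (-l * u))
  have hFi : ∀ n, Integrable (F n) (volume.restrict (Set.Ioi 0)) := fun n => (hup_int_pow n l hl).const_mul _
  have hre : 0 < ((l.re : ℂ)).re := by simpa
  have hnorm : ∀ n, ∫ u in Set.Ioi (0:ℝ), ‖F n u‖ = (b / l.re) ^ (n+1) / (n+1).factorial := by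
    intro n
    have h1 := hup_gamma n (l.re : ℂ) hre
    have h2 : ∫ u in Set.Ioi (0:ℝ), ‖F n u‖ = ∫ u in Set.Ioi (0:ℝ), c n * (u ^ n * Real.exp (-l.re * u)) := by
      refine setIntegral_congr_fun measurableSet_Ioi ?_
      intro u hu
      have hu : 0 < u := hu
      simp [F, Complex.norm_exp, abs_of_pos hu, abs_of_nonneg (hc0 n)]
    rw [h2, integral_const_mul]
    have h3 : ∫ u in Set.Ioi (0:ℝ), (u ^ n * Real.exp (-l.re * u)) = n.factorial / l.re ^ (n+1) := by
      apply Complex.ofReal_injective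
      rw [← integral_complex_ofReal]
      push_cast
      exact h1
    rw [h3, hc, div_pow]
    field_simp
  have hsum : Summable (fun n => ∫ u in Set.Ioi (0:ℝ), ‖F n u‖) := by
    simp_rw [hnorm]
    exact (summable_nat_add_iff 1).2 (Real.summable_pow_div_factorial (b / l.re))
  have hpt : ∀ u : ℝ, HasSum (fun n => F n u) ((hupK b u : ℂ) * Complex.exp (-l * u)) := by
    intro u
    have := (Complex.hasSum_ofReal.2 (hupK_summable b u).hasSum).mul_right (Complex.exp (-l * u))
    have hh : (fun n => F n u) = fun n : ℕ => ((b ^ (n+1) * u ^ n / ((n+1).factorial * n.factorial) : ℝ) : ℂ)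
        * Complex.exp (-l * u) := by
      funext n
      simp only [F, hc]
      push_cast
      ring
    rw [hh]
    exact this
  have key := hasSum_integral_of_summable_integral_norm hFi hsum
  have e : ∀ u, ∑' n, F n u = (hupK b u : ℂ) * Complex.exp (-l * u) := fun u => (hpt u).tsum_eq
  simp_rw [e] at key
  refine key.unique ?_
  have h4 : HasSum (fun n : ℕ => (b / l : ℂ) ^ n / n.factorial) (Complex.exp (b / l)) := by
    rw [Complex.exp_eq_exp_ℂ]
    exact NormedSpace.expSeries_div_hasSum_exp (b / l : ℂ)
  have h5 := (hasSum_nat_add_iff' 1).2 h4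
  simp only [Finset.range_one, Finset.sum_singleton, pow_zero, Nat.factorial_zero, Nat.cast_one, div_one] at h5
  convert h5 using 1
  ext n
  simp only [F]
  rw [integral_const_mul, hup_gamma n l hl, hc]
  have hf1 : ((n+1).factorial : ℂ) ≠ 0 := by exact_mod_cast Nat.factorial_ne_zero _
  have hf2 : (n.factorial : ℂ) ≠ 0 := by exact_mod_cast Nat.factorial_ne_zero _
  push_cast
  rw [div_pow]
  field_simp

lemma hupK_integrable {b : ℝ} (hb : 0 ≤ b) (l : ℂ) (hl : 0 < l.re) :
    IntegrableOn (fun u : ℝ => (hupK b u : ℂ) * Complex.exp (-l * u)) (Set.Ioi 0) := by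
  have hm : Measurable (hupK b) := hupK_measurable.comp measurable_prodMk_left
  rcases hb.eq_or_lt with rfl | hb'
  · have : ∀ u, hupK 0 u = 0 := fun u => by simp [hupK]
    simp [this]
  · have h1 := hupK_laplace hb (l.re : ℂ) (by simpa)
    have h2 : IntegrableOn (fun u : ℝ => (hupK b u : ℂ) * Complex.exp (-(l.re : ℂ) * u)) (Set.Ioi 0) := by
      by_contra hcon
      rw [integral_undef hcon] at h1
      have h3 : Complex.exp (b / (l.re : ℂ)) = 1 := (sub_eq_zero.1 h1.symm)
      rw [← Complex.ofReal_div, ← Complex.ofReal_exp] at h3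
      have h4 : Real.exp (b / l.re) = 1 := by exact_mod_cast h3
      rw [Real.exp_eq_one_iff] at h4
      exact (div_pos hb' hl).ne' h4
    refine Integrable.mono h2 (by fun_prop) ?_
    filter_upwards with u
    simp [Complex.norm_exp]

lemma hup_contract (c : ℝ) (hc : 0 < c) (b : ℝ → ℝ) (hbm : Measurable b) (hb0 : ∀ x, 0 ≤ b x)
    (hb1 : ∀ x, b x ≤ c / 4) (f : ℝ → ℂ) (hf : Integrable f)
    (h : ∀ η : ℝ, ∫ x : ℝ, Complex.exp (-(Complex.I * η * x)) *
      (Complex.exp (b x / (c + Complex.I * η)) * f x) = 0) :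
    ∀ᵐ x, f x = 0 := by
  let q : ℝ → ℝ → ℝ := fun x u => (Set.Ioi (0:ℝ)).indicator (fun u => hupK (b x) u * Real.exp (-c * u)) u
  have hq0 : ∀ x u, 0 ≤ q x u := by
    intro x u
    apply Set.indicator_nonneg
    intro u hu
    exact mul_nonneg (hupK_nonneg (hb0 x) (le_of_lt hu)) (Real.exp_pos _).le
  have hqm : Measurable (fun p : ℝ × ℝ => q p.1 p.2) := by
    have h1 : Measurable (fun p : ℝ × ℝ => hupK (b p.1) p.2 * Real.exp (-c * p.2)) := by
      refine Measurable.mul ?_ (by fun_prop)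
      exact hupK_measurable.comp ((hbm.comp measurable_fst).prodMk measurable_snd)
    have h2 : MeasurableSet {p : ℝ × ℝ | p.2 ∈ Set.Ioi (0:ℝ)} := measurable_snd measurableSet_Ioi
    have h3 : (fun p : ℝ × ℝ => q p.1 p.2) = {p : ℝ × ℝ | p.2 ∈ Set.Ioi (0:ℝ)}.indicator
        (fun p => hupK (b p.1) p.2 * Real.exp (-c * p.2)) := by
      funext p
      simp only [q, Set.indicator_apply, Set.mem_ofPred_eq]
    rw [h3]
    exact h1.indicator h2
  have hqC : ∀ (η x u : ℝ), Complex.exp (-(Complex.I * η * u)) * (q x u : ℂ) =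
      (Set.Ioi (0:ℝ)).indicator (fun u : ℝ => (hupK (b x) u : ℂ) * Complex.exp (-(c + Complex.I * η) * u)) u := by
    intro η x u
    by_cases hu : u ∈ Set.Ioi (0:ℝ)
    · simp only [q, Set.indicator_of_mem hu]
      push_cast
      rw [mul_left_comm, ← Complex.exp_add]
      congr 2
      ring
    · simp only [q, Set.indicator_of_notMem hu]
      simp
  have hre : ∀ η : ℝ, 0 < ((c : ℂ) + Complex.I * η).re := by intro η; simpa using hc
  have hqL : ∀ (η x : ℝ), ∫ u : ℝ, Complex.exp (-(Complex.I * η * u)) * (q x u : ℂ) =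
      Complex.exp (b x / (c + Complex.I * η)) - 1 := by
    intro η x
    simp_rw [hqC]
    rw [integral_indicator measurableSet_Ioi]
    exact hupK_laplace (hb0 x) _ (hre η)
  have hqiC : ∀ x, Integrable (fun u => (q x u : ℂ)) := by
    intro x
    have h1 := (hupK_integrable (hb0 x) _ (hre 0)).integrable_indicator measurableSet_Ioi
    refine h1.congr ?_
    filter_upwards with u
    rw [← hqC 0 x u]
    simp
  have hqi : ∀ x, Integrable (q x) := fun x => by simpa using (hqiC x).re
  have hqint : ∀ x, ∫ u, q x u = Real.exp (b x / c) - 1 := by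
    intro x
    apply Complex.ofReal_injective
    rw [← integral_complex_ofReal]
    have := hqL 0 x
    push_cast
    simpa using this
  have hbd : ∀ x, Real.exp (b x / c) - 1 ≤ 1 / 2 := by
    intro x
    have h1 : b x / c ≤ 1 / 4 := by rw [div_le_iff₀ hc]; linarith [hb1 x]
    have h0 : 0 ≤ b x / c := div_nonneg (hb0 x) hc.le
    have := Real.abs_exp_sub_one_le (x := b x / c) (by rw [abs_of_nonneg h0]; linarith)
    rw [abs_of_nonneg h0] at this
    linarith [le_abs_self (Real.exp (b x / c) - 1)]
  have hbd0 : ∀ x, 0 ≤ Real.exp (b x / c) - 1 := by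
    intro x
    rw [← hqint]; exact integral_nonneg (hq0 x)
  let G : ℝ × ℝ → ℂ := fun p => f p.1 * (q p.1 (p.2 - p.1) : ℂ)
  have hGm : AEStronglyMeasurable G (volume.prod volume) := by
    refine AEStronglyMeasurable.mul hf.1.comp_fst ?_
    have : Measurable (fun p : ℝ × ℝ => q p.1 (p.2 - p.1)) :=
      hqm.comp (measurable_fst.prodMk (measurable_snd.sub measurable_fst))
    exact (Complex.measurable_ofReal.comp this).aestronglyMeasurable
  have hGn : ∀ x y, ‖G (x, y)‖ = ‖f x‖ * q x (y - x) := by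
    intro x y
    simp [G, abs_of_nonneg (hq0 x _)]
  have hGn' : ∀ x, ∫ y, ‖G (x, y)‖ = ‖f x‖ * (Real.exp (b x / c) - 1) := by
    intro x
    simp_rw [hGn]
    rw [integral_const_mul, integral_sub_right_eq_self (fun u => q x u), hqint]
  have hi1 : Integrable (fun x => ‖f x‖ * (Real.exp (b x / c) - 1)) := by
    refine Integrable.mono' hf.norm (hf.1.norm.mul (by fun_prop)) ?_
    filter_upwards with x
    rw [norm_mul, norm_norm, Real.norm_of_nonneg (hbd0 x)]
    nlinarith [hbd x, norm_nonneg (f x)]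
  have hG : Integrable G (volume.prod volume) := by
    rw [integrable_prod_iff hGm]
    constructor
    · filter_upwards with x
      exact ((hqiC x).comp_sub_right x).const_mul (f x)
    · simp_rw [hGn']
      exact hi1
  let Kf : ℝ → ℂ := fun y => ∫ x, G (x, y)
  have hKf : Integrable Kf := hG.integral_prod_right
  have hbddE : ∀ η : ℝ, ∀ u : ℝ, ‖Complex.exp (-(Complex.I * η * u))‖ = 1 := by
    intro η u
    simp [Complex.norm_exp]
  have hFT : ∀ η : ℝ, ∫ y : ℝ, Complex.exp (-(Complex.I * η * y)) * Kf y =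
      ∫ x : ℝ, Complex.exp (-(Complex.I * η * x)) * ((Complex.exp (b x / (c + Complex.I * η)) - 1) * f x) := by
    intro η
    have hH : Integrable (fun p : ℝ × ℝ => Complex.exp (-(Complex.I * η * p.2)) * G p) (volume.prod volume) := by
      refine hG.bdd_mul (c := 1) (by fun_prop) ?_
      filter_upwards with p
      exact (hbddE η p.2).le
    simp only [Kf]
    simp_rw [← integral_const_mul]
    rw [← integral_integral_swap (f := fun x y : ℝ => Complex.exp (-(Complex.I * η * y)) * G (x, y)) hH]
    congr 1; ext x
    rw [← hqL η x, ← integral_sub_right_eq_self (fun u : ℝ => Complex.exp (-(Complex.I * η * u)) * (q x u : ℂ)) x, ← integral_mul_const, ← integral_const_mul]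
    congr 1; ext y
    simp only [G]
    push_cast
    rw [show Complex.exp (-(Complex.I * η * y)) = Complex.exp (-(Complex.I * η * x)) * Complex.exp (-(Complex.I * η * (y - x))) by
      rw [← Complex.exp_add]; congr 1; ring]
    ring
  have hbm' : ∀ η : ℝ, AEStronglyMeasurable (fun x : ℝ => Complex.exp (-(Complex.I * η * x))) := fun η => by fun_prop
  have hEi : ∀ (η : ℝ) (g : ℝ → ℂ), Integrable g → Integrable (fun x : ℝ => Complex.exp (-(Complex.I * η * x)) * g x) := by
    intro η g hg
    refine hg.bdd_mul (c := 1) (hbm' η) ?_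
    filter_upwards with u
    exact (hbddE η u).le
  have hzero := hup_fourier_inj (fun x => f x + Kf x) (hf.add hKf) (by
    intro η
    simp_rw [mul_add]
    rw [integral_add (hEi η f hf) (hEi η Kf hKf), hFT, ← h η]
    have hi2 : Integrable (fun x => (Complex.exp (b x / (c + Complex.I * η)) - 1) * f x) := by
      refine hf.bdd_mul (c := Real.exp (1/4) + 1) (by fun_prop) ?_
      filter_upwards with x
      refine (norm_sub_le _ _).trans ?_
      rw [norm_one, Complex.norm_exp]
      gcongr
      refine (Complex.re_le_norm _).trans ?_
      rw [norm_div, Complex.norm_real, Real.norm_of_nonneg (hb0 x)]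
      have h5 : c ≤ ‖(c : ℂ) + Complex.I * η‖ := by
        have := Complex.re_le_norm ((c : ℂ) + Complex.I * η)
        simpa using this
      rw [div_le_iff₀ (by linarith)]
      linarith [hb1 x]
    rw [← integral_add (hEi η f hf) (hEi η _ hi2)]
    congr 1; ext x; ring)
  have hle : ∫ x, ‖f x‖ ≤ 1 / 2 * ∫ x, ‖f x‖ := by
    calc ∫ y, ‖f y‖ ≤ ∫ y, ∫ x, ‖G (x, y)‖ := by
          refine integral_mono_ae hf.norm hG.norm.integral_prod_right ?_
          filter_upwards [hzero] with y hy
          rw [eq_neg_of_add_eq_zero_left hy, norm_neg]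
          exact norm_integral_le_integral_norm _
      _ = ∫ x, ∫ y, ‖G (x, y)‖ := (integral_integral_swap (f := fun x y : ℝ => ‖G (x, y)‖) hG.norm).symm
      _ = ∫ x, ‖f x‖ * (Real.exp (b x / c) - 1) := by simp_rw [hGn']
      _ ≤ ∫ x, 1 / 2 * ‖f x‖ := by
          refine integral_mono hi1 (hf.norm.const_mul _) ?_
          intro x
          simp only
          nlinarith [hbd x, norm_nonneg (f x)]
      _ = 1 / 2 * ∫ x, ‖f x‖ := integral_const_mul _ _
  have h0 : ∫ x, ‖f x‖ = 0 := le_antisymm (by linarith) (integral_nonneg fun x => norm_nonneg _)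
  rw [integral_eq_zero_iff_of_nonneg (fun x => norm_nonneg _) hf.norm] at h0
  filter_upwards [h0] with x hx
  simpa using hx

/-- The regularised kernel. -/
noncomputable def hupW (A : ℝ) (l : ℂ) (t : ℝ) : ℂ :=
  Complex.exp (-l * Real.exp t - (A * (1 - Real.exp (-t)) : ℝ) / l)

lemma hupW_norm_le {A : ℝ} (hA : 0 ≤ A) {l : ℂ} (hl : 0 ≤ l.re) {t : ℝ} (ht : 0 < t) :
    ‖hupW A l t‖ ≤ Real.exp (-l.re * Real.exp t) := by
  rw [hupW, Complex.norm_exp]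
  apply Real.exp_le_exp.2
  have h1 : Real.exp (-t) ≤ 1 := Real.exp_le_one_iff.2 (by linarith)
  have h2 : 0 ≤ (((A * (1 - Real.exp (-t)) : ℝ) : ℂ) / l).re := by
    rw [div_eq_mul_inv, Complex.re_ofReal_mul, Complex.inv_re]
    exact mul_nonneg (mul_nonneg hA (by linarith)) (div_nonneg hl (Complex.normSq_nonneg _))
  rw [Complex.sub_re, Complex.re_mul_ofReal, Complex.neg_re]
  linarith

lemma hupW_norm_le_one {A : ℝ} (hA : 0 ≤ A) {l : ℂ} (hl : 0 ≤ l.re) {t : ℝ} (ht : 0 < t) :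
    ‖hupW A l t‖ ≤ 1 := by
  refine (hupW_norm_le hA hl ht).trans (Real.exp_le_one_iff.2 ?_)
  nlinarith [Real.exp_pos t]

lemma hupW_meas (A : ℝ) (l : ℂ) : Measurable (hupW A l) := by
  unfold hupW
  fun_prop

lemma hup_diff {A : ℝ} (hA : 0 ≤ A) (g : ℝ → ℂ) (hg : Integrable g) (l : ℂ) (hl : 0 < l.re) :
    DifferentiableAt ℂ (fun l => ∫ t in Set.Ioi (0:ℝ), hupW A l t * g t) l := by
  set δ := l.re / 2 with hδ
  have hδ0 : 0 < δ := by positivity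
  have hs : {w : ℂ | δ < w.re} ∈ nhds l :=
    (isOpen_lt continuous_const Complex.continuous_re).mem_nhds (by simp only [Set.mem_ofPred_eq]; linarith)
  have hgr : Integrable g (volume.restrict (Set.Ioi 0)) := hg.restrict
  have := hasDerivAt_integral_of_dominated_loc_of_deriv_le (μ := volume.restrict (Set.Ioi (0:ℝ)))
    (F := fun l t => hupW A l t * g t) (x₀ := l)
    (F' := fun l t => (hupW A l t * (-Real.exp t + (A * (1 - Real.exp (-t)) : ℝ) / l ^ 2)) * g t)
    (bound := fun t => (1 / δ + A / δ ^ 2) * ‖g t‖) hs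
    (Filter.Eventually.of_forall fun w => (hupW_meas A w).aestronglyMeasurable.mul hgr.1)
    (hgr.bdd_mul (c := 1) (hupW_meas A l).aestronglyMeasurable (by
      filter_upwards [ae_restrict_mem measurableSet_Ioi] with t ht
      exact hupW_norm_le_one hA hl.le ht))
    (((hupW_meas A l).aestronglyMeasurable.mul (by fun_prop)).mul hgr.1)
    (by
      filter_upwards [ae_restrict_mem measurableSet_Ioi] with t ht w hw
      have ht : 0 < t := ht
      have hw : δ < w.re := hw
      rw [norm_mul, norm_mul]
      gcongr
      have hw0 : 0 < w.re := by linarith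
      have e1 := hupW_norm_le hA hw0.le ht
      have e2 := hupW_norm_le_one hA hw0.le ht
      have e3 : ‖(-(Real.exp t : ℂ) + (A * (1 - Real.exp (-t)) : ℝ) / w ^ 2)‖ ≤ Real.exp t + A / δ ^ 2 := by
        refine (norm_add_le _ _).trans ?_
        rw [norm_neg, Complex.norm_real, Real.norm_of_nonneg (Real.exp_pos t).le, norm_div, norm_pow,
          Complex.norm_real]
        have h1 : Real.exp (-t) ≤ 1 := Real.exp_le_one_iff.2 (by linarith)
        rw [Real.norm_of_nonneg (mul_nonneg hA (by linarith))]
        have h3 : δ ≤ ‖w‖ := hw.le.trans (Complex.re_le_norm w)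
        gcongr
        nlinarith [Real.exp_pos (-t)]
      have e4 : ‖hupW A w t‖ * Real.exp t ≤ 1 / δ := by
        rw [le_div_iff₀ hδ0]
        have h5 : ‖hupW A w t‖ ≤ Real.exp (-(δ * Real.exp t)) := by
          refine e1.trans (Real.exp_le_exp.2 ?_)
          nlinarith [Real.exp_pos t]
        have h6 := Real.add_one_le_exp (δ * Real.exp t)
        calc ‖hupW A w t‖ * Real.exp t * δ = ‖hupW A w t‖ * (δ * Real.exp t) := by ring
          _ ≤ Real.exp (-(δ * Real.exp t)) * Real.exp (δ * Real.exp t) := by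
            gcongr
            linarith
          _ = 1 := by rw [← Real.exp_add]; simp
      calc ‖hupW A w t‖ * ‖(-(Real.exp t : ℂ) + (A * (1 - Real.exp (-t)) : ℝ) / w ^ 2)‖ 
          ≤ ‖hupW A w t‖ * (Real.exp t + A / δ ^ 2) := by gcongr
        _ = ‖hupW A w t‖ * Real.exp t + ‖hupW A w t‖ * (A / δ ^ 2) := by ring
        _ ≤ 1 / δ + 1 * (A / δ ^ 2) := by gcongr
        _ = _ := by ring)
    (hgr.norm.const_mul _)
    (by
      filter_upwards with t w hw
      have hw : δ < w.re := hw
      have hw0 : w ≠ 0 := by rintro rfl; simp at hw; linarith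
      apply HasDerivAt.mul_const
      unfold hupW
      have d1 : HasDerivAt (fun w : ℂ => -w * Real.exp t) (-1 * Real.exp t) w :=
        (hasDerivAt_neg w).mul_const _
      have d2 : HasDerivAt (fun w : ℂ => ((A * (1 - Real.exp (-t)) : ℝ) : ℂ) / w)
          (((A * (1 - Real.exp (-t)) : ℝ) : ℂ) * (-(w ^ 2)⁻¹)) w := by
        simpa only [div_eq_mul_inv] using (hasDerivAt_inv hw0).const_mul ((A * (1 - Real.exp (-t)) : ℝ) : ℂ)
      refine (d1.sub d2).cexp.congr_deriv ?_
      congr 1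
      rw [div_eq_mul_inv]
      ring)
  exact this.2.differentiableAt

lemma hup_cont {A : ℝ} (hA : 0 ≤ A) (g : ℝ → ℂ) (hg : Integrable g) :
    ContinuousOn (fun l => ∫ t in Set.Ioi (0:ℝ), hupW A l t * g t) {l : ℂ | 0 ≤ l.re ∧ l ≠ 0} := by
  have hgr : Integrable g (volume.restrict (Set.Ioi 0)) := hg.restrict
  refine continuousOn_of_dominated (bound := fun t => ‖g t‖)
    (fun w _ => (hupW_meas A w).aestronglyMeasurable.mul hgr.1) ?_ hgr.norm ?_
  · intro w hw
    filter_upwards [ae_restrict_mem measurableSet_Ioi] with t ht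
    rw [norm_mul]
    have := hupW_norm_le_one hA hw.1 ht
    nlinarith [norm_nonneg (g t)]
  · filter_upwards with t
    unfold hupW
    have : ContinuousOn (fun w : ℂ => ((A * (1 - Real.exp (-t)) : ℝ) : ℂ) / w) {l : ℂ | 0 ≤ l.re ∧ l ≠ 0} :=
      continuousOn_const.div continuousOn_id (fun w hw => hw.2)
    fun_prop

lemma hup_ext {A : ℝ} (hA : 0 ≤ A) (g : ℝ → ℂ) (hg : Integrable g)
    (h : ∀ y : ℝ, 0 < y → ∫ t in Set.Ioi (0:ℝ), hupW A (Complex.I * y) t * g t = 0)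
    (l : ℂ) (hl : 0 < l.re) : ∫ t in Set.Ioi (0:ℝ), hupW A l t * g t = 0 := by
  have hgr : Integrable g (volume.restrict (Set.Ioi 0)) := hg.restrict
  set Φ : ℂ → ℂ := fun l => ∫ t in Set.Ioi (0:ℝ), hupW A l t * g t with hΦ
  let D : ℂ → ℂ := fun z => Complex.I * Complex.exp (-(Complex.I * π * z))
  have hD0 : ∀ z, D z ≠ 0 := fun z => mul_ne_zero Complex.I_ne_zero (Complex.exp_ne_zero _)
  have hDre : ∀ z, (D z).re = Real.exp (π * z.im) * Real.sin (π * z.re) := by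
    intro z
    simp [D, Complex.exp_im, Complex.exp_re]
  have hDd : Differentiable ℂ D := by intro z; simp only [D]; fun_prop
  have hclosed : ∀ z ∈ Complex.HadamardThreeLines.verticalClosedStrip 0 1, 0 ≤ (D z).re := by
    intro z hz
    have hz : z.re ∈ Set.Icc (0:ℝ) 1 := hz
    rw [hDre]
    refine mul_nonneg (Real.exp_pos _).le (Real.sin_nonneg_of_nonneg_of_le_pi ?_ ?_)
    · exact mul_nonneg Real.pi_pos.le hz.1
    · nlinarith [Real.pi_pos, hz.2]
  have hopen : ∀ z ∈ Complex.HadamardThreeLines.verticalStrip 0 1, 0 < (D z).re := by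
    intro z hz
    have hz : z.re ∈ Set.Ioo (0:ℝ) 1 := hz
    rw [hDre]
    refine mul_pos (Real.exp_pos _) (Real.sin_pos_of_pos_of_lt_pi ?_ ?_)
    · exact mul_pos Real.pi_pos hz.1
    · nlinarith [Real.pi_pos, hz.2]
  have hbound : ∀ w : ℂ, 0 ≤ w.re → ‖Φ w‖ ≤ ∫ t in Set.Ioi (0:ℝ), ‖g t‖ := by
    intro w hw
    refine norm_integral_le_of_norm_le hgr.norm ?_
    filter_upwards [ae_restrict_mem measurableSet_Ioi] with t ht
    rw [norm_mul]
    have := hupW_norm_le_one hA hw ht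
    nlinarith [norm_nonneg (g t)]
  have hcl : closure (Complex.HadamardThreeLines.verticalStrip 0 1) ⊆
      Complex.HadamardThreeLines.verticalClosedStrip 0 1 := by
    refine closure_minimal ?_ ?_
    · exact Set.preimage_mono Set.Ioo_subset_Icc_self
    · exact isClosed_Icc.preimage Complex.continuous_re
  have hdc : DiffContOnCl ℂ (fun z => Φ (D z)) (Complex.HadamardThreeLines.verticalStrip 0 1) := by
    constructor
    · intro z hz
      exact ((hup_diff hA g hg (D z) (hopen z hz)).comp z (hDd z)).differentiableWithinAt
    · refine (hup_cont hA g hg).comp hDd.continuous.continuousOn ?_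
      intro z hz
      exact ⟨hclosed z (hcl hz), hD0 z⟩
  have hB : BddAbove ((norm ∘ (fun z => Φ (D z))) '' Complex.HadamardThreeLines.verticalClosedStrip 0 1) := by
    refine ⟨∫ t in Set.Ioi (0:ℝ), ‖g t‖, ?_⟩
    rintro _ ⟨z, hz, rfl⟩
    exact hbound _ (hclosed z hz)
  have hleft : ∀ z ∈ Complex.re ⁻¹' {(0:ℝ)}, ‖Φ (D z)‖ ≤ 0 := by
    intro z hz
    have hz : z.re = 0 := hz
    have : D z = Complex.I * (Real.exp (π * z.im) : ℝ) := by
      simp only [D]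
      congr 1
      rw [Complex.ofReal_exp]
      congr 1
      apply Complex.ext <;> simp [hz]
    rw [this]
    simp only [hΦ]
    rw [h _ (Real.exp_pos _), norm_zero]
  have hright : ∀ z ∈ Complex.re ⁻¹' {(1:ℝ)}, ‖Φ (D z)‖ ≤ ∫ t in Set.Ioi (0:ℝ), ‖g t‖ := by
    intro z hz
    have hz : z.re = 1 := hz
    exact hbound _ (hclosed z (by
      change z.re ∈ Set.Icc (0:ℝ) 1
      rw [hz]; simp))
  set z : ℂ := Complex.I * Complex.log (-Complex.I * l) / π with hz
  have hpi : (π : ℂ) ≠ 0 := by exact_mod_cast Real.pi_ne_zero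
  have hl0 : l ≠ 0 := by rintro rfl; simp at hl
  have hDz : D z = l := by
    simp only [D]
    rw [show -(Complex.I * π * z) = Complex.log (-Complex.I * l) by
      rw [hz]; field_simp; rw [Complex.I_sq]; ring]
    rw [Complex.exp_log (mul_ne_zero (neg_ne_zero.2 Complex.I_ne_zero) hl0)]
    rw [← mul_assoc]; simp
  have hzre : z.re = -Complex.arg (-Complex.I * l) / π := by
    rw [hz, Complex.div_ofReal_re]
    simp [Complex.log_im]
  have ha1 : Complex.arg (-Complex.I * l) < 0 := by
    rw [Complex.arg_neg_iff]; simpa using hl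
  have ha2 := Complex.neg_pi_lt_arg (-Complex.I * l)
  have hz1 : 0 < z.re := by rw [hzre]; exact div_pos (by linarith) Real.pi_pos
  have hz2 : z.re < 1 := by rw [hzre, div_lt_one Real.pi_pos]; linarith
  have key := Complex.HadamardThreeLines.norm_le_interp_of_mem_verticalClosedStrip₀₁' (fun z => Φ (D z))
    (z := z) ⟨hz1.le, hz2.le⟩ hdc hB hleft hright
  rw [Real.zero_rpow (by linarith), zero_mul, hDz] at key
  exact norm_le_zero_iff.1 key

/-- Heisenberg uniqueness for the branch of the hyperbola `{(cosh t, sinh t) : t ≥ 0}`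
against `{(cosh s, -sinh s) : s ∈ ℝ}`: if `g ∈ L¹[0,∞)` and
`∫₀^∞ e^{-iπ cosh(t-s)} g(t) dt = 0` for all `s ∈ ℝ`, then `g = 0` a.e. -/
theorem hyperbola_branch_HUP (g : ℝ → ℂ) (hg : Integrable g)
    (hsupp : ∀ t < (0 : ℝ), g t = 0)
    (hvanish : ∀ s : ℝ,
      ∫ t in Set.Ioi (0 : ℝ),
        Complex.exp (-(Complex.I * (Real.pi : ℂ) * (Real.cosh (t - s) : ℂ))) * g t = 0) :
    g =ᵐ[volume] 0 := by
  have hpi := Real.pi_pos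
  set A : ℝ := (π / 2) ^ 2 with hAdef
  have hA : 0 < A := by positivity
  -- passage from `hupW` to the non-regularised kernel
  have hWeq : ∀ (l : ℂ) (t : ℝ), hupW A l t =
      Complex.exp (-(A / l)) * Complex.exp (-l * Real.exp t + A * Real.exp (-t) / l) := by
    intro l t
    rw [hupW, ← Complex.exp_add]
    congr 1
    push_cast
    ring
  have h1 : ∀ y : ℝ, 0 < y → ∫ t in Set.Ioi (0:ℝ), hupW A (Complex.I * y) t * g t = 0 := by
    intro y hy
    have hs := hvanish (Real.log (π / 2 / y))
    simp_rw [hWeq, mul_assoc]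
    rw [integral_const_mul, mul_eq_zero]
    right
    rw [← hs]
    congr 1; ext t
    congr 2
    have hy' : (y : ℂ) ≠ 0 := by exact_mod_cast hy.ne'
    have hpi' : (π : ℂ) ≠ 0 := by exact_mod_cast hpi.ne'
    have hq : 0 < π / 2 / y := by positivity
    rw [Real.cosh_eq, Real.exp_sub, neg_sub, Real.exp_sub, Real.exp_log hq, hAdef, Real.exp_neg]
    have het : (Real.exp t : ℂ) ≠ 0 := by exact_mod_cast (Real.exp_pos t).ne'
    push_cast
    push_cast at het
    field_simp
    rw [Complex.I_sq]
    ring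
  have h2 := hup_ext hA.le g hg h1
  have h3 : ∀ l : ℂ, 0 < l.re →
      ∫ t in Set.Ioi (0:ℝ), Complex.exp (-l * Real.exp t + A * Real.exp (-t) / l) * g t = 0 := by
    intro l hl
    have := h2 l hl
    simp_rw [hWeq, mul_assoc] at this
    rw [integral_const_mul, mul_eq_zero] at this
    exact this.resolve_left (Complex.exp_ne_zero _)
  -- change of variables
  set c : ℝ := 4 * A with hc
  have hc0 : 0 < c := by positivity
  let b : ℝ → ℝ := fun x => A / max x 1
  let f₀ : ℝ → ℂ := fun x => Real.exp (-c * x) * (x⁻¹ * g (Real.log x))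
  let f : ℝ → ℂ := (Set.Ioi (1:ℝ)).indicator f₀
  have himg : Real.exp '' Set.Ioi 0 = Set.Ioi 1 := by
    ext x
    constructor
    · rintro ⟨t, ht, rfl⟩
      exact Real.one_lt_exp_iff.2 ht
    · intro hx
      have hx : 1 < x := hx
      exact ⟨Real.log x, Real.log_pos hx, Real.exp_log (by linarith)⟩
  have hder : ∀ t ∈ Set.Ioi (0:ℝ), HasDerivWithinAt Real.exp (Real.exp t) (Set.Ioi 0) t :=
    fun t _ => (Real.hasDerivAt_exp t).hasDerivWithinAt
  have hinj : Set.InjOn Real.exp (Set.Ioi 0) := Real.exp_injective.injOn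
  have hf₀ : ∀ t, |Real.exp t| • f₀ (Real.exp t) = Real.exp (-c * Real.exp t) * g t := by
    intro t
    have het : (Real.exp t : ℂ) ≠ 0 := by exact_mod_cast (Real.exp_pos t).ne'
    simp only [f₀, Real.log_exp, abs_of_pos (Real.exp_pos t), Complex.real_smul]
    rw [Complex.ofReal_inv]
    field_simp
  have hgr : Integrable g (volume.restrict (Set.Ioi 0)) := hg.restrict
  have hf₀i : IntegrableOn f₀ (Set.Ioi 1) := by
    rw [← himg, integrableOn_image_iff_integrableOn_abs_deriv_smul measurableSet_Ioi hder hinj]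
    simp_rw [hf₀]
    refine hgr.bdd_mul (c := 1) (by fun_prop) ?_
    filter_upwards with t
    rw [Complex.norm_real, Real.norm_of_nonneg (Real.exp_pos _).le, Real.exp_le_one_iff]
    nlinarith [Real.exp_pos t]
  have hfi : Integrable f := hf₀i.integrable_indicator measurableSet_Ioi
  have hfz := hup_contract c hc0 b (by simp only [b]; fun_prop)
    (fun x => div_nonneg hA.le (by positivity))
    (fun x => by
      simp only [b]
      rw [hc, mul_div_cancel_left₀ A (by norm_num : (4:ℝ) ≠ 0)]
      exact div_le_self hA.le (le_max_right _ _)) f hfi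
    (by
      intro η
      have e1 : (fun x : ℝ => Complex.exp (-(Complex.I * η * x)) *
          (Complex.exp (b x / (c + Complex.I * η)) * f x)) = (Set.Ioi (1:ℝ)).indicator
          (fun x : ℝ => Complex.exp (-(Complex.I * η * x)) *
          (Complex.exp (b x / (c + Complex.I * η)) * f₀ x)) := by
        funext x
        by_cases hx : x ∈ Set.Ioi (1:ℝ)
        · simp only [f, Set.indicator_of_mem hx]
        · simp only [f, Set.indicator_of_notMem hx, mul_zero]
      rw [e1, integral_indicator measurableSet_Ioi, ← himg,
        integral_image_eq_integral_abs_deriv_smul measurableSet_Ioi hder hinj,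
        ← h3 (c + Complex.I * η) (by simpa using hc0)]
      refine setIntegral_congr_fun measurableSet_Ioi ?_
      intro t ht
      have ht : 0 < t := ht
      simp only
      rw [← mul_smul_comm, ← mul_smul_comm, hf₀]
      have hb : b (Real.exp t) = A * Real.exp (-t) := by
        simp only [b]
        rw [max_eq_left (Real.one_le_exp ht.le), Real.exp_neg]
        rfl
      rw [hb, Complex.ofReal_exp (-c * Real.exp t), ← mul_assoc, ← mul_assoc, ← Complex.exp_add,
        ← Complex.exp_add]
      congr 2
      push_cast
      ring)
  have hz : ∫ x in Set.Ioi (1:ℝ), ‖f₀ x‖ = 0 := by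
    rw [← integral_indicator measurableSet_Ioi]
    rw [integral_eq_zero_of_ae]
    filter_upwards [hfz] with x hx
    by_cases hx1 : x ∈ Set.Ioi (1:ℝ)
    · simp only [f, Set.indicator_of_mem hx1] at hx
      simp [Set.indicator_of_mem hx1, hx]
    · simp [Set.indicator_of_notMem hx1]
  rw [← himg, integral_image_eq_integral_abs_deriv_smul measurableSet_Ioi hder hinj] at hz
  have hn : ∀ t, |Real.exp t| • ‖f₀ (Real.exp t)‖ = ‖(Real.exp (-c * Real.exp t) : ℂ) * g t‖ := by
    intro t
    rw [← hf₀, norm_smul, Real.norm_eq_abs, abs_abs, smul_eq_mul]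
  simp_rw [hn] at hz
  have hint : Integrable (fun t => ‖(Real.exp (-c * Real.exp t) : ℂ) * g t‖) (volume.restrict (Set.Ioi 0)) := by
    have := hf₀i
    rw [← himg, integrableOn_image_iff_integrableOn_abs_deriv_smul measurableSet_Ioi hder hinj] at this
    simp_rw [hf₀] at this
    exact this.norm
  rw [integral_eq_zero_iff_of_nonneg (fun t => norm_nonneg _) hint] at hz
  have hz' := (ae_restrict_iff' measurableSet_Ioi).1 hz
  have hne : ∀ᵐ t : ℝ, t ≠ 0 := by simp [ae_iff, measure_singleton]
  filter_upwards [hz', hne] with t ht ht0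
  rcases lt_or_gt_of_ne ht0 with hneg | hpos
  · exact hsupp t hneg
  · have := ht hpos
    simpa using this
end
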